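/- For every nonzero polynomial f ∈ ℂ[z₁,…,zₙ], every connected component of the complement ℝⁿ \ 𝓘(f) of the imaginary projection is convex. -/

import Mathlib

section
open MvPolynomial

/-- The imaginary projection of a polynomial `f ∈ ℂ[z₁,…,zₙ]`. -/
def imagProj {n : ℕ} (f : MvPolynomial (Fin n) ℂ) : Set (Fin n → ℝ) :=
  {y | ∃ z : Fin n → ℂ, eval z f = 0 ∧ (fun j => (z j).im) = y}
end

section
open Polynomial

/-- number of distinct complex roots -/
noncomputable def nroots (P : ℝ[X]) : Finset ℂ := (P.map (algebraMap ℝ ℂ)).roots.toFinset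

theorem mem_nroots {P : ℝ[X]} (hP : P ≠ 0) {z : ℂ} :
    z ∈ nroots P ↔ (P.map (algebraMap ℝ ℂ)).eval z = 0 := by
  have : P.map (algebraMap ℝ ℂ) ≠ 0 := by
    rwa [Ne, Polynomial.map_eq_zero]
  simp [nroots, this]

theorem card_le_of_rel {P A B : ℂ[X]} (hP : P ≠ 0) (hB : B ≠ 0) {k : ℕ}
    (hBk : B.degree < (k + 1 : ℕ)) (h : A * P = B * derivative P) :
    P.roots.toFinset.card ≤ k := by
  have hsub : P.roots.toFinset ⊆ B.roots.toFinset := by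
    intro r hr
    simp only [Multiset.mem_toFinset, mem_roots hP, mem_roots hB] at hr ⊢
    have hP' : derivative P ≠ 0 := by
      intro h0
      have := derivative_eq_zero.1 h0
      rw [eq_C_of_natDegree_eq_zero this] at hr hP
      simp at hr hP
      exact hP hr
    have hA : A ≠ 0 := by
      rintro rfl
      rw [zero_mul] at h
      exact mul_ne_zero hB hP' h.symm
    have h1 := congrArg (rootMultiplicity r) h
    rw [rootMultiplicity_mul (mul_ne_zero hA hP), rootMultiplicity_mul (mul_ne_zero hB hP'),
      derivative_rootMultiplicity_of_root hr] at h1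
    have h2 : 0 < rootMultiplicity r P := (rootMultiplicity_pos hP).2 hr
    have : 0 < rootMultiplicity r B := by omega
    exact (rootMultiplicity_pos hB).1 this
  have h3 := (Finset.card_le_card hsub).trans (Multiset.toFinset_card_le _)
  have h4 := card_roots' B
  have h5 := (natDegree_lt_iff_degree_lt hB).2 hBk
  omega

theorem exists_rel {P : ℂ[X]} (hP : P ≠ 0) {k : ℕ} (hk : P.roots.toFinset.card ≤ k) :
    ∃ A B : ℂ[X], B ≠ 0 ∧ A.degree < k ∧ B.degree < (k + 1 : ℕ) ∧ A * P = B * derivative P := by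
  set B : ℂ[X] := ∏ r ∈ P.roots.toFinset, (X - C r) with hBdef
  have hB : B ≠ 0 := Finset.prod_ne_zero_iff.2 fun r _ => X_sub_C_ne_zero r
  have hBdeg : B.degree = P.roots.toFinset.card := by
    rw [hBdef, degree_prod]; simp
  have hdvd : P ∣ B * derivative P := by
    by_cases hP' : derivative P = 0
    · simp [hP']
    have hne := mul_ne_zero hB hP'
    have hs : P.Splits := IsAlgClosed.splits P
    refine (hs.dvd_iff_roots_le_roots hP hne).2 ?_
    rw [Multiset.le_iff_count]
    intro r
    rw [roots_mul hne, Multiset.count_add]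
    by_cases hr : r ∈ P.roots
    · have h1 : B.roots = P.roots.toFinset.val := by
        rw [hBdef]; exact roots_prod_X_sub_C _
      have h2 : Multiset.count r B.roots = 1 := by
        rw [h1]
        exact Multiset.count_eq_one_of_mem P.roots.toFinset.nodup (by simpa using hr)
      have h3 := derivative_rootMultiplicity_of_root ((mem_roots hP).1 hr)
      rw [h2, count_roots, count_roots, h3]
      omega
    · simp [Multiset.count_eq_zero_of_notMem hr]
  obtain ⟨A, hA⟩ := hdvd
  have hA' : A * P = B * derivative P := by rw [hA]; ring
  refine ⟨A, B, hB, ?_, ?_, hA'⟩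
  · have h1 := congrArg degree hA'
    rw [degree_mul, degree_mul] at h1
    have h2 := degree_derivative_lt hP
    have h3 : A.degree < B.degree := by
      by_contra hlt
      push Not at hlt
      by_cases hA0 : A = 0
      · simp [hA0, hB] at hlt
      rw [degree_eq_natDegree hA0, degree_eq_natDegree hP, degree_eq_natDegree hB] at *
      by_cases hP' : derivative P = 0
      · rw [hP'] at h1; simp at h1
      rw [degree_eq_natDegree hP'] at *
      norm_cast at *
      omega
    rw [hBdeg] at h3
    exact h3.trans_le (by exact_mod_cast hk)
  · rw [hBdeg]; exact_mod_cast Nat.lt_succ_of_le hk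

section
variable {R : Type*} [CommRing R]

/-- Sylvester-like matrix -/
noncomputable def sylM (P : R[X]) (N k : ℕ) : Matrix (Fin (N + k + 1)) (Fin k ⊕ Fin (k + 1)) R :=
  fun r => Sum.elim (fun i => (X ^ (i : ℕ) * P).coeff r) (fun j => -(X ^ (j : ℕ) * derivative P).coeff r)

theorem sylM_map {S : Type*} [CommRing S] (g : R →+* S) (P : R[X]) (N k : ℕ) :
    (sylM P N k).map g = sylM (P.map g) N k := by
  ext r (i | j)
  · simp only [sylM, Matrix.map_apply, Sum.elim_inl]
    rw [← coeff_map]; simp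
  · simp only [sylM, Matrix.map_apply, Sum.elim_inr, map_neg]
    rw [← coeff_map]; simp [derivative_map]

theorem sylM_mulVec (P : R[X]) (N k : ℕ) (v : Fin k ⊕ Fin (k + 1) → R) (r : Fin (N + k + 1)) :
    (sylM P N k).mulVec v r = ((∑ i, C (v (Sum.inl i)) * X ^ (i : ℕ)) * P
      - (∑ j, C (v (Sum.inr j)) * X ^ (j : ℕ)) * derivative P).coeff r := by
  rw [coeff_sub, sub_eq_add_neg, Finset.sum_mul, Finset.sum_mul, finsetSum_coeff, finsetSum_coeff,
    ← Finset.sum_neg_distrib]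
  simp only [Matrix.mulVec, dotProduct, Fintype.sum_sum_type, sylM, Sum.elim_inl, Sum.elim_inr,
    mul_assoc, coeff_C_mul]
  congr 1 <;> refine Finset.sum_congr rfl fun i _ => by ring

theorem sum_deg_lt (k : ℕ) (v : Fin k → R) : (∑ i, C (v i) * X ^ (i : ℕ) : R[X]).degree < k := by
  have := degree_sum_fin_lt v
  simpa [C_mul_X_pow_eq_monomial] using this

theorem sum_eq_of_deg_lt {k : ℕ} {A : R[X]} (hA : A.degree < k) :
    (∑ i : Fin k, C (A.coeff i) * X ^ (i : ℕ) : R[X]) = A := by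
  rw [Fin.sum_univ_eq_sum_range (fun i => C (A.coeff i) * X ^ i)]
  by_cases h : A = 0
  · simp [h]
  exact (as_sum_range_C_mul_X_pow' A ((natDegree_lt_iff_degree_lt h).2 hA)).symm

theorem sylM_ker (P : R[X]) {N : ℕ} (hN : P.natDegree ≤ N) (k : ℕ) (v : Fin k ⊕ Fin (k + 1) → R) :
    (sylM P N k).mulVec v = 0 ↔ (∑ i, C (v (Sum.inl i)) * X ^ (i : ℕ)) * P
      = (∑ j, C (v (Sum.inr j)) * X ^ (j : ℕ)) * derivative P := by
  rw [← sub_eq_zero (b := _ * derivative P)]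
  set Q := (∑ i, C (v (Sum.inl i)) * X ^ (i : ℕ)) * P
      - (∑ j, C (v (Sum.inr j)) * X ^ (j : ℕ)) * derivative P with hQ
  have hdeg : Q.degree < (N + k + 1 : ℕ) := by
    have h1 := sum_deg_lt k (fun i => v (Sum.inl i))
    have h2 := sum_deg_lt (k + 1) (fun i => v (Sum.inr i))
    have h3 : P.degree ≤ (N : ℕ) := natDegree_le_iff_degree_le.1 hN
    have h4 : (derivative P).degree ≤ (N : ℕ) := (degree_derivative_le).trans h3
    refine (degree_sub_le _ _).trans_lt (max_lt ?_ ?_)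
    · refine (degree_lt_iff_coeff_zero _ _).2 fun m hm => ?_
      refine coeff_eq_zero_of_degree_lt ((degree_mul_le _ _).trans_lt ?_)
      calc _ ≤ ((k : ℕ) : WithBot ℕ) + (N : ℕ) := add_le_add h1.le h3
        _ < (m : ℕ) := by norm_cast; omega
    · refine (degree_lt_iff_coeff_zero _ _).2 fun m hm => ?_
      refine coeff_eq_zero_of_degree_lt ((degree_mul_le _ _).trans_lt ?_)
      have h2' : (∑ i, C (v (Sum.inr i)) * X ^ (i : ℕ) : R[X]).degree ≤ (k : ℕ) := by
        refine (degree_le_iff_coeff_zero _ _).2 fun m hm => ?_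
        refine coeff_eq_zero_of_degree_lt (h2.trans_le ?_)
        exact_mod_cast hm
      calc _ ≤ ((k : ℕ) : WithBot ℕ) + (N : ℕ) := add_le_add h2' h4
        _ < (m : ℕ) := by norm_cast; omega
  constructor
  · intro h
    ext m
    by_cases hm : m < N + k + 1
    · have := congrFun h ⟨m, hm⟩
      rw [sylM_mulVec, ← hQ] at this
      simpa using this
    · exact coeff_eq_zero_of_degree_lt (hdeg.trans_le (by exact_mod_cast not_lt.1 hm))
  · intro h
    ext r
    rw [sylM_mulVec, ← hQ, h]; simp

noncomputable def gramD (P : R[X]) (N k : ℕ) : R := ((sylM P N k).transpose * sylM P N k).det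

theorem gramD_map {S : Type*} [CommRing S] (g : R →+* S) (P : R[X]) (N k : ℕ) :
    g (gramD P N k) = gramD (P.map g) N k := by
  unfold gramD
  rw [RingHom.map_det, ← sylM_map]
  simp [Matrix.map_mul, Matrix.transpose_map]
end

theorem gramD_eq_zero_iff {P : ℝ[X]} (hP : P ≠ 0) {N : ℕ} (hN : P.natDegree ≤ N) (k : ℕ) :
    gramD P N k = 0 ↔ (nroots P).card ≤ k := by
  have hPC : P.map (algebraMap ℝ ℂ) ≠ 0 := by rwa [Ne, Polynomial.map_eq_zero]
  constructor
  · intro h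
    obtain ⟨v, hv, hv2⟩ := Matrix.exists_mulVec_eq_zero_iff.2 h
    have h1 : (sylM P N k).mulVec v = 0 := by
      have : v ∈ ((sylM P N k).transpose * sylM P N k).mulVecLin.ker := by
        rw [LinearMap.mem_ker, Matrix.mulVecLin_apply]; exact hv2
      rw [Matrix.ker_mulVecLin_transpose_mul_self] at this
      simpa using this
    rw [sylM_ker P hN] at h1
    set A : ℝ[X] := ∑ i, C (v (Sum.inl i)) * X ^ (i : ℕ)
    set B : ℝ[X] := ∑ i, C (v (Sum.inr i)) * X ^ (i : ℕ) with hBd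
    have hBdeg : B.degree < (k + 1 : ℕ) := sum_deg_lt (k + 1) (fun i => v (Sum.inr i))
    have hB : B ≠ 0 := by
      intro hB0
      have hA0 : A = 0 := by
        rw [hB0, zero_mul] at h1
        exact (mul_eq_zero.1 h1).resolve_right hP
      apply hv
      ext (i | j)
      · have := congrArg (fun p => coeff p i) hA0
        simpa [A, finsetSum_coeff, coeff_C_mul, coeff_X_pow, Fin.val_inj] using this
      · have := congrArg (fun p => coeff p j) hB0
        simpa [B, finsetSum_coeff, coeff_C_mul, coeff_X_pow, Fin.val_inj] using this
    refine card_le_of_rel (A := A.map (algebraMap ℝ ℂ)) (B := B.map (algebraMap ℝ ℂ)) hPC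
      (by rwa [Ne, Polynomial.map_eq_zero]) (by rwa [degree_map]) ?_
    rw [derivative_map, ← Polynomial.map_mul, ← Polynomial.map_mul, h1]
  · intro h
    obtain ⟨A, B, hB, hAk, hBk, hAB⟩ := exists_rel hPC h
    have h0 : gramD (P.map (algebraMap ℝ ℂ)) N k = 0 := by
      refine Matrix.exists_mulVec_eq_zero_iff.1
        ⟨Sum.elim (fun i => A.coeff i) (fun j => B.coeff j), ?_, ?_⟩
      · intro hv
        apply hB
        rw [← sum_eq_of_deg_lt hBk]
        refine Finset.sum_eq_zero fun j _ => ?_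
        have := congrFun hv (Sum.inr j)
        simp at this
        simp [this]
      · rw [← Matrix.mulVec_mulVec, (sylM_ker _ (by rwa [natDegree_map]) k _).2, Matrix.mulVec_zero]
        simp only [Sum.elim_inl, Sum.elim_inr]
        rw [sum_eq_of_deg_lt hAk, sum_eq_of_deg_lt hBk, hAB]
    rw [← gramD_map] at h0
    simpa using h0

theorem exists_root_near {P : ℂ[X]} {δ : ℝ} (hδ : 0 ≤ δ) (ρ : ℂ)
    (h : ‖P.eval ρ‖ < ‖P.leadingCoeff‖ * δ ^ P.natDegree) (hP : P ≠ 0) :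
    ∃ r, P.eval r = 0 ∧ ‖r - ρ‖ < δ := by
  by_contra hcon
  push Not at hcon
  have hs : P.Splits := IsAlgClosed.splits P
  have h1 := hs.eq_prod_roots
  have h2 : P.eval ρ = P.leadingCoeff * (P.roots.map fun a => ρ - a).prod := by
    conv_lhs => rw [h1]
    simp [eval_multiset_prod, Multiset.map_map]
  have h3 : δ ^ P.natDegree ≤ ‖(P.roots.map fun a => ρ - a).prod‖ := by
    rw [hs.natDegree_eq_card_roots]
    have hall : ∀ a ∈ P.roots, δ ≤ ‖ρ - a‖ := fun a ha => by
      rw [norm_sub_rev]; exact hcon a ((mem_roots hP).1 ha)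
    generalize P.roots = s at hall
    induction s using Multiset.induction with
    | empty => simp
    | cons a s ih =>
      simp only [Multiset.card_cons, Multiset.map_cons, Multiset.prod_cons, norm_mul, pow_succ']
      exact mul_le_mul (hall a (by simp)) (ih fun b hb => hall b (by simp [hb])) (by positivity)
        (norm_nonneg _)
  rw [h2, norm_mul] at h
  have := mul_le_mul_of_nonneg_left h3 (norm_nonneg P.leadingCoeff)
  linarith

end

section
open Polynomial Filter Topology

section roots
variable {X : Type*} [TopologicalSpace X]

/-- a continuous family of nonzero real polynomials of constant degree on D -/
structure GoodFam (P : X → ℝ[X]) (D : Set X) : Prop where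
  cont : ∀ i, Continuous fun x => (P x).coeff i
  ne : ∀ x ∈ D, P x ≠ 0
  deg : ∃ d, ∀ x ∈ D, (P x).natDegree = d

theorem GoodFam.contEval {P : X → ℝ[X]} {D : Set X} (h : GoodFam P D) (ρ : ℂ) :
    ContinuousOn (fun x => ((P x).map (algebraMap ℝ ℂ)).eval ρ) D := by
  obtain ⟨d, hd⟩ := h.deg
  have h1 : ContinuousOn (fun x => ∑ i ∈ Finset.range (d + 1), ((P x).coeff i : ℂ) * ρ ^ i) D := by
    refine Continuous.continuousOn ?_
    refine continuous_finsetSum _ fun i _ => ?_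
    exact (Complex.continuous_ofReal.comp (h.cont i)).mul continuous_const
  refine h1.congr fun x hx => ?_
  rw [eval_eq_sum_range' (n := d + 1)]
  · simp
  · rw [natDegree_map, hd x hx]; omega

theorem GoodFam.pers {P : X → ℝ[X]} {D : Set X} (h : GoodFam P D) {x₀ : X} (hx₀ : x₀ ∈ D) {ρ : ℂ}
    (hρ : ρ ∈ nroots (P x₀)) {δ : ℝ} (hδ : 0 < δ) :
    ∀ᶠ x in 𝓝[D] x₀, ∃ s ∈ nroots (P x), ‖s - ρ‖ < δ := by
  obtain ⟨d, hd⟩ := h.deg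
  rw [mem_nroots (h.ne _ hx₀)] at hρ
  have h1 : Tendsto (fun x => ‖((P x).map (algebraMap ℝ ℂ)).eval ρ‖) (𝓝[D] x₀) (𝓝 0) := by
    have := (h.contEval ρ x₀ hx₀).norm
    rwa [ContinuousWithinAt, hρ, norm_zero] at this
  have h2 : Tendsto (fun x => ‖(P x).coeff d‖ * δ ^ d) (𝓝[D] x₀) (𝓝 (‖(P x₀).coeff d‖ * δ ^ d)) :=
    ((((h.cont d).norm).mul continuous_const).tendsto x₀).mono_left nhdsWithin_le_nhds
  have h3 : 0 < ‖(P x₀).coeff d‖ * δ ^ d := by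
    have : (P x₀).coeff d ≠ 0 := by
      rw [← hd x₀ hx₀, coeff_natDegree, leadingCoeff_ne_zero]; exact h.ne _ hx₀
    positivity
  filter_upwards [h1.eventually_lt h2 h3, self_mem_nhdsWithin] with x hx hxD
  have hne : (P x).map (algebraMap ℝ ℂ) ≠ 0 := by
    rw [Ne, Polynomial.map_eq_zero]; exact h.ne x hxD
  obtain ⟨r, hr, hr2⟩ := exists_root_near hδ.le ρ (P := (P x).map (algebraMap ℝ ℂ)) (by
    rw [natDegree_map, leadingCoeff_map, hd x hxD, leadingCoeff, hd x hxD]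
    simpa using hx) hne
  exact ⟨r, (mem_nroots (h.ne x hxD)).2 hr, hr2⟩

theorem exists_sep (W : Finset ℂ) {ε : ℝ} (hε : 0 < ε) : ∃ δ, 0 < δ ∧ δ ≤ ε ∧
    (∀ r ∈ W, ∀ r' ∈ W, r ≠ r' → 2 * δ < ‖r - r'‖) ∧ ∀ r ∈ W, r.im ≠ 0 → δ < |r.im| := by
  have key : ∀ c : ℝ, 0 < c → ∀ᶠ δ in 𝓝[>] (0 : ℝ), 2 * δ < c := fun c hc => by
    have : ∀ᶠ δ in 𝓝 (0 : ℝ), 2 * δ < c := by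
      have hc' : Continuous fun δ : ℝ => 2 * δ := by fun_prop
      exact (hc'.tendsto 0).eventually_lt_const (by simpa using hc)
    exact nhdsWithin_le_nhds this
  have h1 : ∀ᶠ δ in 𝓝[>] (0 : ℝ), ∀ r ∈ W, ∀ r' ∈ W, r ≠ r' → 2 * δ < ‖r - r'‖ := by
    rw [Filter.eventually_all_finset]; intro r _
    rw [Filter.eventually_all_finset]; intro r' _
    by_cases h : r = r'
    · simp [h]
    · filter_upwards [key _ (norm_pos_iff.2 (sub_ne_zero.2 h))] with δ hδ _ using hδ
  have h2 : ∀ᶠ δ in 𝓝[>] (0 : ℝ), ∀ r ∈ W, r.im ≠ 0 → δ < |r.im| := by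
    rw [Filter.eventually_all_finset]; intro r _
    by_cases h : r.im = 0
    · simp [h]
    · filter_upwards [key _ (abs_pos.2 h), self_mem_nhdsWithin] with δ hδ h0 _
      have : (0:ℝ) < δ := h0
      linarith
  obtain ⟨δ, a, b, c, d⟩ := (h1.and (h2.and ((key (2 * ε) (by linarith)).and self_mem_nhdsWithin))).exists
  exact ⟨δ, d, by linarith, a, b⟩

theorem GoodFam.loc {P : X → ℝ[X]} {D : Set X} (h : GoodFam P D) {k : ℕ}
    (hk : ∀ x ∈ D, (nroots (P x)).card = k) {x₀ : X} (hx₀ : x₀ ∈ D) {ε : ℝ} (hε : 0 < ε) :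
    ∃ δ, 0 < δ ∧ δ ≤ ε ∧
    (∀ r ∈ nroots (P x₀), ∀ r' ∈ nroots (P x₀), r ≠ r' → 2 * δ < ‖r - r'‖) ∧
    (∀ r ∈ nroots (P x₀), r.im ≠ 0 → δ < |r.im|) ∧
    ∀ᶠ x in 𝓝[D] x₀, (∀ r ∈ nroots (P x₀), ∃ s ∈ nroots (P x), ‖s - r‖ < δ) ∧
      (∀ s ∈ nroots (P x), ∃ r ∈ nroots (P x₀), ‖s - r‖ < δ) ∧
      (∀ r ∈ nroots (P x₀), ∀ s ∈ nroots (P x), ∀ s' ∈ nroots (P x),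
        ‖s - r‖ < δ → ‖s' - r‖ < δ → s = s') := by
  obtain ⟨δ, h0, h1, h2, h3⟩ := exists_sep (nroots (P x₀)) hε
  refine ⟨δ, h0, h1, h2, h3, ?_⟩
  have h4 : ∀ᶠ x in 𝓝[D] x₀, ∀ r ∈ nroots (P x₀), ∃ s ∈ nroots (P x), ‖s - r‖ < δ := by
    rw [Filter.eventually_all_finset]; intro r hr
    exact h.pers hx₀ hr h0
  filter_upwards [h4, self_mem_nhdsWithin] with x hx hxD
  have hx' := hx
  choose! σ hσ hσ2 using hx'
  have uniq : ∀ r ∈ nroots (P x₀), ∀ r' ∈ nroots (P x₀), ∀ s, ‖s - r‖ < δ → ‖s - r'‖ < δ → r = r' := by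
    intro r hr r' hr' s hs hs'
    by_contra hne
    have := h2 r hr r' hr' hne
    have h5 : ‖r - r'‖ ≤ ‖s - r'‖ + ‖s - r‖ := by
      have := norm_sub_le (s - r') (s - r)
      simpa using this
    linarith
  have hinj : Set.InjOn σ (nroots (P x₀)) := by
    intro r hr r' hr' he
    exact uniq r hr r' hr' (σ r) (hσ2 r hr) (he ▸ hσ2 r' hr')
  have hsurj := Finset.surjOn_of_injOn_of_card_le σ (s := nroots (P x₀)) (t := nroots (P x))
    (fun r hr => hσ r hr) hinj (by rw [hk x hxD, hk x₀ hx₀])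
  refine ⟨hx, fun s hs => ?_, fun r hr s hs s' hs' hd hd' => ?_⟩
  · obtain ⟨r, hr, rfl⟩ := hsurj hs
    exact ⟨r, hr, hσ2 r hr⟩
  · obtain ⟨r1, hr1, rfl⟩ := hsurj hs
    obtain ⟨r2, hr2, rfl⟩ := hsurj hs'
    rw [uniq r1 hr1 r hr _ (hσ2 r1 hr1) hd, uniq r2 hr2 r hr _ (hσ2 r2 hr2) hd']

theorem ofReal_mem_nroots {P : ℝ[X]} (hP : P ≠ 0) {t : ℝ} : (t : ℂ) ∈ nroots P ↔ t ∈ P.roots.toFinset := by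
  rw [mem_nroots hP]
  have : (P.map (algebraMap ℝ ℂ)).eval (t : ℂ) = ((P.eval t : ℝ) : ℂ) := by
    rw [← Complex.coe_algebraMap, eval_map_algebraMap, aeval_algebraMap_apply]; simp
  rw [this]; simp [hP]

theorem conj_mem_nroots {P : ℝ[X]} (hP : P ≠ 0) {t : ℂ} (h : t ∈ nroots P) :
    (starRingEnd ℂ) t ∈ nroots P := by
  rw [mem_nroots hP, eval_map_algebraMap] at *
  rw [aeval_conj, h, map_zero]

theorem GoodFam.loc_real {P : X → ℝ[X]} {D : Set X} (h : GoodFam P D) {k : ℕ}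
    (hk : ∀ x ∈ D, (nroots (P x)).card = k) {x₀ : X} (hx₀ : x₀ ∈ D) {ε : ℝ} (hε : 0 < ε) :
    ∃ δ, 0 < δ ∧ δ ≤ ε ∧
    (∀ r ∈ (P x₀).roots.toFinset, ∀ r' ∈ (P x₀).roots.toFinset, r ≠ r' → 2 * δ < |r - r'|) ∧
    ∀ᶠ x in 𝓝[D] x₀, (∀ r ∈ (P x₀).roots.toFinset, ∃ s ∈ (P x).roots.toFinset, |s - r| < δ) ∧
      (∀ s ∈ (P x).roots.toFinset, ∃ r ∈ (P x₀).roots.toFinset, |s - r| < δ) ∧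
      (∀ r ∈ (P x₀).roots.toFinset, ∀ s ∈ nroots (P x), ∀ s' ∈ nroots (P x),
        ‖s - r‖ < δ → ‖s' - r‖ < δ → s = s') := by
  obtain ⟨δ, h0, h1, h2, h3, h4⟩ := h.loc hk hx₀ hε
  have hn0 := h.ne x₀ hx₀
  refine ⟨δ, h0, h1, fun r hr r' hr' hne => ?_, ?_⟩
  · have := h2 r ((ofReal_mem_nroots hn0).2 hr) r' ((ofReal_mem_nroots hn0).2 hr') (by simpa using hne)
    rwa [← Complex.ofReal_sub, Complex.norm_real] at this
  filter_upwards [h4, self_mem_nhdsWithin] with x hx hxD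
  obtain ⟨ha, hb, hc⟩ := hx
  have hn := h.ne x hxD
  refine ⟨fun r hr => ?_, fun s hs => ?_, fun r hr => hc r ((ofReal_mem_nroots hn0).2 hr)⟩
  · have hr' := (ofReal_mem_nroots hn0).2 hr
    obtain ⟨s, hs, hsd⟩ := ha r hr'
    have hcs : (starRingEnd ℂ) s = s := by
      refine hc r hr' _ (conj_mem_nroots hn hs) s hs ?_ hsd
      have : (starRingEnd ℂ) s - r = (starRingEnd ℂ) (s - r) := by simp
      rw [this, Complex.norm_conj]; exact hsd
    obtain ⟨t, rfl⟩ := Complex.conj_eq_iff_real.1 hcs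
    refine ⟨t, (ofReal_mem_nroots hn).1 hs, ?_⟩
    rwa [← Complex.ofReal_sub, Complex.norm_real] at hsd
  · obtain ⟨r, hr, hrd⟩ := hb s ((ofReal_mem_nroots hn).2 hs)
    have him : r.im = 0 := by
      by_contra hne
      have h5 := h3 r hr hne
      have h6 := (Complex.abs_im_le_norm ((s : ℂ) - r)).trans_lt hrd
      simp at h6
      linarith
    have hrr : r = (r.re : ℂ) := by apply Complex.ext <;> simp [him]
    rw [hrr] at hr hrd
    refine ⟨r.re, (ofReal_mem_nroots hn0).1 hr, ?_⟩
    rwa [← Complex.ofReal_sub, Complex.norm_real] at hrd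

theorem GoodFam.locCard {P : X → ℝ[X]} {D : Set X} (h : GoodFam P D) {k : ℕ}
    (hk : ∀ x ∈ D, (nroots (P x)).card = k) {x₀ : X} (hx₀ : x₀ ∈ D) {ε : ℝ} (hε : 0 < ε) :
    ∀ᶠ x in 𝓝[D] x₀, ∃ σ : ℝ → ℝ, StrictMonoOn σ (P x₀).roots.toFinset ∧
      σ '' (P x₀).roots.toFinset = (P x).roots.toFinset ∧
      ∀ r ∈ (P x₀).roots.toFinset, |σ r - r| < ε := by
  obtain ⟨δ, h0, h1, h2, h3⟩ := h.loc_real hk hx₀ hε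
  filter_upwards [h3, self_mem_nhdsWithin] with x hx hxD
  obtain ⟨ha, hb, hc⟩ := hx
  have hn := h.ne x hxD
  choose! σ hσ hσ2 using ha
  refine ⟨σ, ?_, ?_, fun r hr => (hσ2 r hr).trans_le h1⟩
  · intro r hr r' hr' hlt
    have h4 := h2 r hr r' hr' hlt.ne
    have h5 := hσ2 r hr
    have h6 := hσ2 r' hr'
    rw [abs_of_neg (by linarith)] at h4
    rw [abs_lt] at h5 h6
    linarith
  · ext s
    constructor
    · rintro ⟨r, hr, rfl⟩; exact hσ r hr
    · intro hs
      obtain ⟨r, hr, hrd⟩ := hb s hs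
      refine ⟨r, hr, ?_⟩
      have := hc r hr (σ r) ((ofReal_mem_nroots hn).2 (hσ r hr)) s ((ofReal_mem_nroots hn).2 hs)
        (by rw [← Complex.ofReal_sub, Complex.norm_real]; exact hσ2 r hr)
        (by rw [← Complex.ofReal_sub, Complex.norm_real]; exact hrd)
      exact_mod_cast this

theorem GoodFam.rootFun {P : X → ℝ[X]} {D : Set X} (h : GoodFam P D) {k : ℕ}
    (hk : ∀ x ∈ D, (nroots (P x)).card = k) (hD : IsPreconnected D) :
    ∃ (l : ℕ) (ξ : Fin l → X → ℝ), (∀ x ∈ D, StrictMono fun i => ξ i x) ∧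
      (∀ x ∈ D, ∀ t, (P x).eval t = 0 ↔ ∃ i, ξ i x = t) ∧ ∀ i, ContinuousOn (ξ i) D := by
  rcases D.eq_empty_or_nonempty with rfl | ⟨x₁, hx₁⟩
  · exact ⟨0, fun _ _ => 0, by simp, by simp, by simp⟩
  set l := (P x₁).roots.toFinset.card with hl
  have hcard : ∀ x ∈ D, (P x).roots.toFinset.card = l := by
    intro x hx
    refine hD.induction₂ (fun x y => (P x).roots.toFinset.card = (P y).roots.toFinset.card)
      (fun x hx => ?_) (fun _ _ _ _ _ _ => Eq.trans) (fun _ _ _ _ => Eq.symm) hx hx₁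
    filter_upwards [h.locCard hk hx one_pos] with y ⟨σ, hσ, hσ2, _⟩
    rw [← Finset.coe_image, Finset.coe_inj] at hσ2
    rw [← hσ2, Finset.card_image_of_injOn hσ.injOn]
  have hex : ∀ x, ∃ e : Fin l → ℝ, x ∈ D → StrictMono e ∧ Set.range e = (P x).roots.toFinset := by
    intro x
    by_cases hx : x ∈ D
    · refine ⟨(P x).roots.toFinset.orderEmbOfFin (hcard x hx), fun _ => ⟨OrderEmbedding.strictMono _, ?_⟩⟩
      simp
    · exact ⟨fun _ => 0, fun h => absurd h hx⟩
  choose e he using hex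
  refine ⟨l, fun i x => e x i, fun x hx => (he x hx).1, fun x hx t => ?_, fun i x₀ hx₀ => ?_⟩
  · have := (he x hx).2
    have h2 : t ∈ Set.range (e x) ↔ t ∈ ((P x).roots.toFinset : Set ℝ) := by rw [this]
    rw [Set.mem_range] at h2
    rw [h2]; simp [h.ne x hx]
  · rw [ContinuousWithinAt, Metric.tendsto_nhds]
    intro ε hε
    filter_upwards [h.locCard hk hx₀ hε, self_mem_nhdsWithin] with x ⟨σ, hσ, hσ2, hσ3⟩ hxD
    obtain ⟨m0, r0⟩ := he x₀ hx₀
    obtain ⟨m1, r1⟩ := he x hxD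
    have hm : ∀ i, e x₀ i ∈ ((P x₀).roots.toFinset : Set ℝ) := fun i => by
      rw [← r0]; exact Set.mem_range_self i
    have : (fun i => σ (e x₀ i)) = e x := by
      refine (StrictMono.range_inj (f := fun i => σ (e x₀ i)) (fun i j hij => hσ (hm i) (hm j) (m0 hij)) m1).1 ?_
      rw [r1, ← hσ2, ← r0, ← Set.range_comp]; rfl
    have h5 := congrFun this i
    rw [← h5, Real.dist_eq]
    exact hσ3 _ (hm i)

theorem GoodFam.graph_inv {P Q : X → ℝ[X]} {D : Set X} (h : GoodFam P D) {k : ℕ}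
    (hk : ∀ x ∈ D, (nroots (P x)).card = k) (hD : IsPreconnected D)
    (hQ : GoodFam Q D) (hdvd : ∀ x ∈ D, Q x ∣ P x) {ξ : X → ℝ}
    (hξ : ∀ x ∈ D, (P x).eval (ξ x) = 0) (hc : ContinuousOn ξ D) :
    (∀ x ∈ D, (Q x).eval (ξ x) = 0) ∨ (∀ x ∈ D, (Q x).eval (ξ x) ≠ 0) := by
  have key : ∀ x ∈ D, ∀ y ∈ D, ((Q x).eval (ξ x) = 0 ↔ (Q y).eval (ξ y) = 0) := by
    intro x hx y hy
    refine hD.induction₂ (fun x y => ((Q x).eval (ξ x) = 0 ↔ (Q y).eval (ξ y) = 0))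
      (fun x hx => ?_) (fun _ _ _ _ _ _ => Iff.trans) (fun _ _ _ _ => Iff.symm) hx hy
    by_cases h0 : (Q x).eval (ξ x) = 0
    · obtain ⟨δ, p0, p1, p2, p3⟩ := h.loc_real hk hx one_pos
      have hr : ξ x ∈ (P x).roots.toFinset := by simp [h.ne x hx, hξ x hx]
      have hr2 : ((ξ x : ℝ) : ℂ) ∈ nroots (Q x) := by
        rw [ofReal_mem_nroots (hQ.ne x hx)]; simp [hQ.ne x hx, h0]
      have hcx : ∀ᶠ y in 𝓝[D] x, |ξ y - ξ x| < δ := by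
        have := Metric.tendsto_nhds.1 (hc x hx) δ p0
        simpa [Real.dist_eq] using this
      filter_upwards [p3, hQ.pers hx hr2 p0, hcx, self_mem_nhdsWithin] with y ⟨_, _, hy⟩ ⟨s, hs, hsd⟩ hd hyD
      have hsP : s ∈ nroots (P y) := by
        rw [mem_nroots (h.ne y hyD)]
        rw [mem_nroots (hQ.ne y hyD)] at hs
        exact eval_eq_zero_of_dvd_of_eval_eq_zero (Polynomial.map_dvd _ (hdvd y hyD)) hs
      have hyP : ((ξ y : ℝ) : ℂ) ∈ nroots (P y) := by
        rw [ofReal_mem_nroots (h.ne y hyD)]; simp [h.ne y hyD, hξ y hyD]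
      have := hy _ hr s hsP _ hyP hsd (by rw [← Complex.ofReal_sub, Complex.norm_real]; exact hd)
      rw [this, ofReal_mem_nroots (hQ.ne y hyD)] at hs
      simp [hQ.ne y hyD] at hs
      simp [h0, hs]
    · have hcx : ContinuousOn (fun y => (Q y).eval (ξ y)) D := by
        obtain ⟨d, hd⟩ := hQ.deg
        have h1 : ContinuousOn (fun x => ∑ i ∈ Finset.range (d + 1), (Q x).coeff i * ξ x ^ i) D := by
          refine continuousOn_finsetSum _ fun i _ => ?_
          exact (hQ.cont i).continuousOn.mul (hc.pow i)
        refine h1.congr fun x hx => ?_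
        rw [eval_eq_sum_range' (n := d + 1)]
        rw [hd x hx]; omega
      filter_upwards [(hcx x hx).eventually_ne h0] with y hy
      simp [h0, hy]
  by_cases hall : ∀ x ∈ D, (Q x).eval (ξ x) = 0
  · exact Or.inl hall
  · right
    push Not at hall
    obtain ⟨x, hx, hne⟩ := hall
    intro y hy h0
    exact hne ((key x hx y hy).2 h0)
end roots

end

section
open Polynomial Filter Topology
open scoped ContDiff

section sj
variable {V : Type*} [NormedAddCommGroup V] [NormedSpace ℝ V]

/-- smoothly joined inside E -/
def SJ (E : Set V) (a b : V) : Prop :=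
  ∃ γ : ℝ → V, ContDiff ℝ ∞ γ ∧ (∀ t, γ t ∈ E) ∧ γ 0 = a ∧ γ 1 = b

def SC (E : Set V) : Prop := ∀ a ∈ E, ∀ b ∈ E, SJ E a b

theorem psi_contDiff : ContDiff ℝ ∞ Real.smoothTransition := Real.smoothTransition.contDiff

theorem SJ.refl {E : Set V} {a : V} (ha : a ∈ E) : SJ E a a :=
  ⟨fun _ => a, contDiff_const, fun _ => ha, rfl, rfl⟩

theorem SJ.symm {E : Set V} {a b : V} (h : SJ E a b) : SJ E b a := by
  obtain ⟨γ, h1, h2, h3, h4⟩ := h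
  exact ⟨fun t => γ (1 - t), h1.comp (by fun_prop), fun t => h2 _, by simpa using h4, by simpa using h3⟩

theorem SJ.trans {E : Set V} {a b c : V} (h : SJ E a b) (h' : SJ E b c) : SJ E a c := by
  obtain ⟨γ, h1, h2, h3, h4⟩ := h
  obtain ⟨γ', h1', h2', h3', h4'⟩ := h'
  refine ⟨fun t => γ (Real.smoothTransition (2 * t)) + γ' (Real.smoothTransition (2 * t - 1)) - b,
    ?_, fun t => ?_, ?_, ?_⟩
  · refine ((h1.comp (psi_contDiff.comp (by fun_prop))).add
      (h1'.comp (psi_contDiff.comp (by fun_prop)))).sub contDiff_const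
  · beta_reduce
    rcases le_total t (1/2) with ht | ht
    · rw [Real.smoothTransition.zero_of_nonpos (x := 2 * t - 1) (by linarith), h3']
      simpa using h2 _
    · rw [Real.smoothTransition.one_of_one_le (x := 2 * t) (by linarith), h4]
      simpa using h2' _
  · simp only [mul_zero]
    rw [Real.smoothTransition.zero_of_nonpos (x := 0 - 1) (by norm_num),
      Real.smoothTransition.zero_of_nonpos (x := 0) (by norm_num), h3, h3']
    simp
  · simp only [mul_one]
    rw [Real.smoothTransition.one_of_one_le (x := 2 - 1) (by norm_num),
      Real.smoothTransition.one_of_one_le (x := 2) (by norm_num), h4, h4']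
    simp

theorem SJ.mono {E F : Set V} (hEF : E ⊆ F) {a b : V} (h : SJ E a b) : SJ F a b := by
  obtain ⟨γ, h1, h2, h3⟩ := h
  exact ⟨γ, h1, fun t => hEF (h2 t), h3⟩

theorem SJ.of_segment {E : Set V} {a b : V} (h : segment ℝ a b ⊆ E) : SJ E a b := by
  refine ⟨fun t => a + Real.smoothTransition t • (b - a), ?_, fun t => h ?_, by simp, by simp⟩
  · exact contDiff_const.add (psi_contDiff.smul contDiff_const)
  · rw [segment_eq_image']
    exact ⟨_, ⟨Real.smoothTransition.nonneg _, Real.smoothTransition.le_one _⟩, rfl⟩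

theorem SC.preconnected {E : Set V} (h : SC E) : IsPreconnected E := by
  refine isPreconnected_of_forall_pair fun x hx y hy => ?_
  obtain ⟨γ, h1, h2, h3, h4⟩ := h x hx y hy
  exact ⟨Set.range γ, by rintro _ ⟨t, rfl⟩; exact h2 t, ⟨0, h3⟩, ⟨1, h4⟩,
    isPreconnected_range h1.continuous⟩
end sj

theorem implicit_smooth {G : ℝ × ℝ → ℝ} (hG : ContDiff ℝ ∞ G) {ξ : ℝ → ℝ} (hξ : Continuous ξ)
    (h0 : ∀ s, G (s, ξ s) = 0) (h1 : ∀ s, ∃ g', g' ≠ 0 ∧ HasDerivAt (fun t => G (s, t)) g' (ξ s)) :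
    ContDiff ℝ ∞ ξ := by
  rw [contDiff_iff_contDiffAt]
  intro s₀
  set p : ℝ × ℝ := (s₀, ξ s₀) with hp
  set F : ℝ × ℝ → ℝ × ℝ := fun q => (q.1, G q) with hF
  have hFs : ContDiff ℝ ∞ F := contDiff_fst.prodMk hG
  set G' := fderiv ℝ G p with hG'
  have hGd : HasFDerivAt G G' p := (hG.differentiable (by simp) p).hasFDerivAt
  set α := G' (1, 0)
  set β := G' (0, 1) with hβd
  have hβ : β ≠ 0 := by
    obtain ⟨g', hg', hd⟩ := h1 s₀
    have h2 : HasDerivAt (fun t => G (s₀, t)) β (ξ s₀) := by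
      have h3 : HasDerivAt (fun t : ℝ => ((s₀, t) : ℝ × ℝ)) ((0 : ℝ), (1 : ℝ)) (ξ s₀) :=
        (hasDerivAt_const _ _).prodMk (hasDerivAt_id _)
      exact HasFDerivAt.comp_hasDerivAt (ξ s₀) hGd h3
    rw [h2.unique hd]; exact hg'
  have hG'e : ∀ q : ℝ × ℝ, G' q = q.1 * α + q.2 * β := by
    intro q
    have : q = q.1 • ((1 : ℝ), (0 : ℝ)) + q.2 • ((0 : ℝ), (1 : ℝ)) := by ext <;> simp
    conv_lhs => rw [this]
    rw [map_add, map_smul, map_smul]; rfl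
  set L : (ℝ × ℝ) ≃L[ℝ] (ℝ × ℝ) := ContinuousLinearEquiv.equivOfInverse
    ((ContinuousLinearMap.fst ℝ ℝ ℝ).prod G')
    ((ContinuousLinearMap.fst ℝ ℝ ℝ).prod (β⁻¹ • (ContinuousLinearMap.snd ℝ ℝ ℝ
      - α • ContinuousLinearMap.fst ℝ ℝ ℝ)))
    (by intro q; ext <;> simp [hG'e]; field_simp; ring)
    (by intro q; ext <;> simp [hG'e]; field_simp; ring) with hL
  have hFd : HasFDerivAt F (L : (ℝ × ℝ) →L[ℝ] (ℝ × ℝ)) p := by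
    exact (hasFDerivAt_fst).prodMk hGd
  have hFa : ContDiffAt ℝ ∞ F p := hFs.contDiffAt
  have hinv := hFa.to_localInverse hFd (by simp)
  have hev : ∀ᶠ s in 𝓝 s₀, (s, ξ s) ∈ (hFa.toOpenPartialHomeomorph F hFd (by simp)).source := by
    have hc : Continuous fun s => (s, ξ s) := by fun_prop
    exact (hc.tendsto s₀).eventually (((hFa.toOpenPartialHomeomorph F hFd (by simp)).open_source.mem_nhds
      (hFa.mem_toOpenPartialHomeomorph_source hFd (by simp))))
  have heq : (fun s => (hFa.localInverse hFd (by simp) (s, 0)).2) =ᶠ[𝓝 s₀] ξ := by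
    filter_upwards [hev] with s hs
    have h3 := (hFa.toOpenPartialHomeomorph F hFd (by simp)).left_inv hs
    have h4 : (hFa.toOpenPartialHomeomorph F hFd (by simp)) (s, ξ s) = (s, 0) := by
      rw [ContDiffAt.toOpenPartialHomeomorph_coe]; simp [hF, h0]
    rw [h4] at h3
    change ((hFa.toOpenPartialHomeomorph F hFd (by simp)).symm (s, 0)).2 = ξ s
    rw [h3]
  refine ContDiffAt.congr_of_eventuallyEq ?_ heq.symm
  have hFp : F p = (s₀, 0) := by simp [hF, hp, h0]
  rw [hFp] at hinv
  exact contDiff_snd.contDiffAt.comp s₀ (hinv.comp s₀ (contDiff_id.prodMk contDiff_const).contDiffAt)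

theorem mvpoly_contDiff {m : ℕ} (φ : MvPolynomial (Fin m) ℝ) :
    ContDiff ℝ ∞ fun x : Fin m → ℝ => MvPolynomial.eval x φ := by
  induction φ using MvPolynomial.induction_on with
  | C a => simpa using contDiff_const
  | add p q hp hq => simpa using hp.add hq
  | mul_X p i hp => simpa using hp.mul (contDiff_apply ℝ ℝ i)

theorem cons_contDiff {m : ℕ} {W : Type*} [NormedAddCommGroup W] [NormedSpace ℝ W] {t : W → ℝ}
    {x : W → Fin m → ℝ} (ht : ContDiff ℝ ∞ t) (hx : ContDiff ℝ ∞ x) :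
    ContDiff ℝ ∞ fun w => (Fin.cons (t w) (x w) : Fin (m + 1) → ℝ) := by
  rw [contDiff_pi]
  intro i
  refine Fin.cases ?_ (fun j => ?_) i
  · simpa using ht
  · simpa using (contDiff_pi.1 hx j)

/-- zero-pattern invariance -/
def ZInv {m : ℕ} (Ψ : Finset (MvPolynomial (Fin m) ℝ)) (D : Set (Fin m → ℝ)) : Prop :=
  ∀ ψ ∈ Ψ, (∀ x ∈ D, MvPolynomial.eval x ψ = 0) ∨ (∀ x ∈ D, MvPolynomial.eval x ψ ≠ 0)

theorem cell_SC {m : ℕ} {D : Set (Fin m → ℝ)} (hD : SC D) {E : Set (Fin (m + 1) → ℝ)}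
    (s : (Fin m → ℝ) → ℝ) (hs : ∀ x ∈ D, (Fin.cons (s x) x : Fin (m + 1) → ℝ) ∈ E)
    (hE : ∀ p ∈ E, Fin.tail p ∈ D)
    (hconv : ∀ x t t', (Fin.cons t x : Fin (m + 1) → ℝ) ∈ E → (Fin.cons t' x : Fin (m + 1) → ℝ) ∈ E →
      ∀ r ∈ segment ℝ t t', (Fin.cons r x : Fin (m + 1) → ℝ) ∈ E)
    (hsm : ∀ β : ℝ → (Fin m → ℝ), ContDiff ℝ ∞ β → (∀ t, β t ∈ D) → ContDiff ℝ ∞ fun t => s (β t)) :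
    SC E ∧ Fin.tail '' E = D := by
  constructor
  · have vert : ∀ p ∈ E, SJ E p (Fin.cons (s (Fin.tail p)) (Fin.tail p)) := by
      intro p hp
      have hp' := hs _ (hE p hp)
      refine SJ.of_segment ?_
      rw [segment_eq_image']
      rintro _ ⟨θ, hθ, rfl⟩
      have hpe : p = Fin.cons (p 0) (Fin.tail p) := (Fin.cons_self_tail p).symm
      have := hconv (Fin.tail p) (p 0) (s (Fin.tail p)) (by rwa [← hpe]) hp'
        (p 0 + θ • (s (Fin.tail p) - p 0)) (by rw [segment_eq_image']; exact ⟨θ, hθ, rfl⟩)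
      convert this using 1
      ext i
      refine Fin.cases ?_ (fun j => ?_) i
      · simp
      · simp [Fin.tail]
    intro a ha b hb
    refine (vert a ha).trans (SJ.trans ?_ (vert b hb).symm)
    obtain ⟨β, h1, h2, h3, h4⟩ := hD _ (hE a ha) _ (hE b hb)
    exact ⟨fun t => Fin.cons (s (β t)) (β t), cons_contDiff (hsm β h1 h2) h1, fun t => hs _ (h2 t),
      by simp [h3], by simp [h4]⟩
  · ext x
    constructor
    · rintro ⟨p, hp, rfl⟩; exact hE p hp
    · intro hx
      exact ⟨_, hs x hx, by simp⟩

end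

section
open Polynomial Filter Topology
open scoped ContDiff

section elim
variable {m : ℕ}

/-- specialisation -/
noncomputable def spz (p : Polynomial (MvPolynomial (Fin m) ℝ)) (x : Fin m → ℝ) : Polynomial ℝ :=
  p.map (MvPolynomial.eval x)

theorem spz_eval (φ : MvPolynomial (Fin (m + 1)) ℝ) (x : Fin m → ℝ) (t : ℝ) :
    MvPolynomial.eval (Fin.cons t x : Fin (m + 1) → ℝ) φ
      = (spz (MvPolynomial.finSuccEquiv ℝ m φ) x).eval t :=
  MvPolynomial.eval_eq_eval_mv_eval' _ _ _

theorem spz_cont (p : Polynomial (MvPolynomial (Fin m) ℝ)) (i : ℕ) :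
    Continuous fun x => (spz p x).coeff i := by
  simp only [spz, coeff_map]
  exact (mvpoly_contDiff _).continuous

theorem spz_goodFam {p : Polynomial (MvPolynomial (Fin m) ℝ)} {D : Set (Fin m → ℝ)}
    (h : ∀ i ∈ Finset.range (p.natDegree + 1), (∀ x ∈ D, MvPolynomial.eval x (p.coeff i) = 0) ∨
      (∀ x ∈ D, MvPolynomial.eval x (p.coeff i) ≠ 0)) :
    (∀ x ∈ D, spz p x = 0) ∨ GoodFam (spz p) D := by
  have h' : ∀ i, (∀ x ∈ D, (spz p x).coeff i = 0) ∨ (∀ x ∈ D, (spz p x).coeff i ≠ 0) := by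
    intro i
    simp only [spz, coeff_map]
    by_cases hi : i ∈ Finset.range (p.natDegree + 1)
    · exact h i hi
    · left
      intro x _
      rw [coeff_eq_zero_of_natDegree_lt (by simpa using hi), map_zero]
  have key : ∀ x ∈ D, ∀ y ∈ D, ∀ i, (spz p x).coeff i = 0 → (spz p y).coeff i = 0 := by
    intro x hx y hy i h0
    rcases h' i with h1 | h1
    · exact h1 y hy
    · exact absurd h0 (h1 x hx)
  by_cases hz : ∀ x ∈ D, spz p x = 0
  · exact Or.inl hz
  right
  push Not at hz
  obtain ⟨x₀, hx₀, hne⟩ := hz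
  have hd : ∀ x ∈ D, ∀ y ∈ D, (spz p x).natDegree ≤ (spz p y).natDegree := by
    intro x hx y hy
    rw [natDegree_le_iff_coeff_eq_zero]
    intro N hN
    exact key y hy x hx N (coeff_eq_zero_of_natDegree_lt hN)
  refine ⟨spz_cont p, fun x hx h0 => hne ?_, (spz p x₀).natDegree, fun x hx =>
    le_antisymm (hd x hx x₀ hx₀) (hd x₀ hx₀ x hx)⟩
  ext i
  simpa using key x hx x₀ hx₀ i (by simp [h0])

theorem spz_derivative (p : Polynomial (MvPolynomial (Fin m) ℝ)) (x : Fin m → ℝ) :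
    spz (derivative p) x = derivative (spz p x) := by
  simp [spz, derivative_map]

theorem spz_prod (T : Finset (Polynomial (MvPolynomial (Fin m) ℝ))) (x : Fin m → ℝ) :
    spz (∏ q ∈ T, q) x = ∏ q ∈ T, spz q x := by
  simp [spz, Polynomial.map_prod]

/-- derivative-closed hull -/
noncomputable def dHull (Φ : Finset (MvPolynomial (Fin (m + 1)) ℝ)) :
    Finset (Polynomial (MvPolynomial (Fin m) ℝ)) := by
  classical
  exact (Φ.image (MvPolynomial.finSuccEquiv ℝ m)).biUnion
    fun p => (Finset.range (p.natDegree + 2)).image fun j => derivative^[j] p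

theorem dHull_der {Φ : Finset (MvPolynomial (Fin (m + 1)) ℝ)} {q} (hq : q ∈ dHull Φ) :
    derivative q ∈ dHull Φ := by
  classical
  simp only [dHull, Finset.mem_biUnion, Finset.mem_image, Finset.mem_range] at hq ⊢
  obtain ⟨p, hp, j, hj, rfl⟩ := hq
  by_cases h : j + 1 < p.natDegree + 2
  · exact ⟨p, hp, j + 1, h, by rw [Function.iterate_succ_apply']⟩
  · refine ⟨p, hp, j, hj, ?_⟩
    rw [iterate_derivative_eq_zero (by omega)]; simp

theorem dHull_self {Φ : Finset (MvPolynomial (Fin (m + 1)) ℝ)} {φ} (hφ : φ ∈ Φ) :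
    MvPolynomial.finSuccEquiv ℝ m φ ∈ dHull Φ := by
  classical
  simp only [dHull, Finset.mem_biUnion, Finset.mem_image, Finset.mem_range]
  exact ⟨_, ⟨φ, hφ, rfl⟩, 0, by omega, rfl⟩

/-- smooth along smooth curves of D -/
def SmD (D : Set (Fin m → ℝ)) (s : (Fin m → ℝ) → ℝ) : Prop :=
  ∀ β : ℝ → (Fin m → ℝ), ContDiff ℝ ∞ β → (∀ t, β t ∈ D) → ContDiff ℝ ∞ fun t => s (β t)

theorem simple_factor {Φ : Finset (MvPolynomial (Fin (m + 1)) ℝ)} {x₀ : Fin m → ℝ} {r : ℝ} :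
    ∀ (d : ℕ) (q), q ∈ dHull Φ → (spz q x₀).natDegree ≤ d → spz q x₀ ≠ 0 → (spz q x₀).eval r = 0 →
    ∃ g ∈ dHull Φ, spz g x₀ ≠ 0 ∧ (spz g x₀).eval r = 0 ∧ (spz (derivative g) x₀).eval r ≠ 0 := by
  intro d
  induction d with
  | zero =>
    intro q hq hd hne h0
    rw [eq_C_of_natDegree_le_zero hd] at h0 hne
    simp at h0 hne
    exact absurd h0 hne
  | succ d ih =>
    intro q hq hd hne h0
    by_cases h1 : (spz (derivative q) x₀).eval r = 0
    · have hpos : 0 < (spz q x₀).natDegree := by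
        by_contra hc
        rw [eq_C_of_natDegree_le_zero (p := spz q x₀) (by omega)] at h0 hne
        simp at h0 hne
        exact hne h0
      refine ih (derivative q) (dHull_der hq) ?_ ?_ h1
      · rw [spz_derivative]
        have := natDegree_derivative_lt hpos.ne'
        omega
      · rw [spz_derivative]
        intro h
        have := derivative_eq_zero.1 h
        omega
    · exact ⟨q, hq, hne, h0, h1⟩

theorem section_exists {D : Set (Fin m → ℝ)} {l : ℕ} {ξ : Fin l → (Fin m → ℝ) → ℝ}
    (hm : ∀ x ∈ D, StrictMono fun i => ξ i x) (hs : ∀ i, SmD D (ξ i)) (A : Finset (Fin l))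
    {x₁ : Fin m → ℝ} (hx₁ : x₁ ∈ D) {t₁ : ℝ}
    (h₁ : ∀ j, (j ∈ A → ξ j x₁ < t₁) ∧ (j ∉ A → t₁ < ξ j x₁)) :
    ∃ s, SmD D s ∧ ∀ x ∈ D, ∀ j, (j ∈ A → ξ j x < s x) ∧ (j ∉ A → s x < ξ j x) := by
  classical
  have hmm : ∀ x ∈ D, ∀ i j, i ≤ j → ξ i x ≤ ξ j x := fun x hx i j hij => (hm x hx).monotone hij
  rcases A.eq_empty_or_nonempty with hA | hA
  · rcases (Aᶜ).eq_empty_or_nonempty with hB | hB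
    · refine ⟨fun _ => 0, fun β _ _ => contDiff_const, fun x hx j => ?_⟩
      have : j ∈ A ∨ j ∈ Aᶜ := by simp [em]
      rw [hB, hA] at this
      simp at this
    · refine ⟨fun x => ξ ((Aᶜ).min' hB) x - 1, fun β h1 h2 => (hs _ β h1 h2).sub contDiff_const,
        fun x hx j => ⟨fun h => by simp [hA] at h, fun h => ?_⟩⟩
      have := hmm x hx _ _ ((Aᶜ).min'_le j (by simpa using h))
      linarith
  · rcases (Aᶜ).eq_empty_or_nonempty with hB | hB
    · refine ⟨fun x => ξ (A.max' hA) x + 1, fun β h1 h2 => (hs _ β h1 h2).add contDiff_const,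
        fun x hx j => ⟨fun h => ?_, fun h => ?_⟩⟩
      · have := hmm x hx _ _ (A.le_max' j h)
        linarith
      · have : j ∈ Aᶜ := by simpa using h
        simp [hB] at this
    · have hab : A.max' hA < (Aᶜ).min' hB := by
        rw [← (hm x₁ hx₁).lt_iff_lt]
        have h2 := (h₁ _).1 (A.max'_mem hA)
        have h3 := (h₁ _).2 (by simpa using (Aᶜ).min'_mem hB)
        exact h2.trans h3
      refine ⟨fun x => (ξ (A.max' hA) x + ξ ((Aᶜ).min' hB) x) / 2, fun β h1 h2 =>
        ((hs _ β h1 h2).add (hs _ β h1 h2)).div_const _, fun x hx j => ⟨fun h => ?_, fun h => ?_⟩⟩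
      · have := hmm x hx _ _ (A.le_max' j h)
        have := hm x hx hab
        simp only at this
        linarith
      · have := hmm x hx _ _ ((Aᶜ).min'_le j (by simpa using h))
        have := hm x hx hab
        simp only at this
        linarith

/-- projection set -/
noncomputable def projSet (Φ : Finset (MvPolynomial (Fin (m + 1)) ℝ)) :
    Finset (MvPolynomial (Fin m) ℝ) := by
  classical
  exact ((dHull Φ).biUnion fun p => (Finset.range (p.natDegree + 1)).image fun i => p.coeff i) ∪
    (dHull Φ).powerset.biUnion fun T =>
      (Finset.range ((∏ q ∈ T, q).natDegree + 1)).image fun k =>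
        gramD (∏ q ∈ T, q) (∏ q ∈ T, q).natDegree k

theorem elim_step (Φ : Finset (MvPolynomial (Fin (m + 1)) ℝ)) {D : Set (Fin m → ℝ)} (hD : SC D)
    (hI : ZInv (projSet Φ) D) :
    ∃ 𝒞 : Set (Set (Fin (m + 1) → ℝ)), 𝒞.Finite ∧
      (∀ E ∈ 𝒞, SC E ∧ ZInv Φ E ∧ Fin.tail '' E = D) ∧ Fin.tail ⁻¹' D ⊆ ⋃₀ 𝒞 := by
  classical
  rcases D.eq_empty_or_nonempty with rfl | ⟨x₀, hx₀⟩
  · exact ⟨∅, by simp, by simp, by simp⟩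
  have hDp := hD.preconnected
  have hcoef : ∀ p ∈ dHull Φ, (∀ x ∈ D, spz p x = 0) ∨ GoodFam (spz p) D := by
    intro p hp
    refine spz_goodFam fun i hi => hI _ ?_
    simp only [projSet, Finset.mem_union, Finset.mem_biUnion, Finset.mem_image]
    exact Or.inl ⟨p, hp, i, hi, rfl⟩
  set T := (dHull Φ).filter fun p => spz p x₀ ≠ 0 with hT
  have hTG : ∀ p ∈ T, GoodFam (spz p) D := by
    intro p hp
    rw [hT, Finset.mem_filter] at hp
    rcases hcoef p hp.1 with h | h
    · exact absurd (h x₀ hx₀) hp.2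
    · exact h
  have hTn : ∀ p ∈ dHull Φ, p ∉ T → ∀ x ∈ D, spz p x = 0 := by
    intro p hp hpT
    rcases hcoef p hp with h | h
    · exact h
    · exact absurd (Finset.mem_filter.2 ⟨hp, h.ne x₀ hx₀⟩) hpT
  set P := ∏ q ∈ T, q with hP
  have hPG : GoodFam (spz P) D := by
    refine ⟨spz_cont P, fun x hx => ?_, ∑ q ∈ T, (spz q x₀).natDegree, fun x hx => ?_⟩
    · rw [hP, spz_prod, Finset.prod_ne_zero_iff]
      exact fun q hq => (hTG q hq).ne x hx
    · rw [hP, spz_prod, natDegree_prod _ _ fun q hq => (hTG q hq).ne x hx]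
      refine Finset.sum_congr rfl fun q hq => ?_
      obtain ⟨d, hd⟩ := (hTG q hq).deg
      rw [hd x hx, hd x₀ hx₀]
  have hdvd : ∀ q ∈ T, ∀ x ∈ D, spz q x ∣ spz P x := by
    intro q hq x _
    rw [hP, spz_prod]
    exact Finset.dvd_prod_of_mem _ hq
  have hdeg : ∀ x, (spz P x).natDegree ≤ P.natDegree := fun x => natDegree_map_le
  have hcard : ∀ x ∈ D, (nroots (spz P x)).card ≤ P.natDegree := by
    intro x hx
    calc _ ≤ Multiset.card ((spz P x).map (algebraMap ℝ ℂ)).roots := Multiset.toFinset_card_le _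
      _ ≤ _ := (card_roots' _).trans (natDegree_map_le.trans (hdeg x))
  have hcc : ∀ x ∈ D, ∀ y ∈ D, (nroots (spz P y)).card ≤ (nroots (spz P x)).card := by
    intro x hx y hy
    rw [← gramD_eq_zero_iff (hPG.ne y hy) (hdeg y)]
    have hx0 : gramD (spz P x) P.natDegree (nroots (spz P x)).card = 0 := by
      rw [gramD_eq_zero_iff (hPG.ne x hx) (hdeg x)]
    unfold spz at hx0 ⊢
    rw [← gramD_map] at hx0 ⊢
    rcases hI (gramD P P.natDegree (nroots (spz P x)).card) (by
      simp only [projSet, Finset.mem_union, Finset.mem_biUnion, Finset.mem_image]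
      refine Or.inr ⟨T, by simp [hT], _, ?_, rfl⟩
      rw [Finset.mem_range]
      exact Nat.lt_succ_of_le (hcard x hx)) with h | h
    · exact h y hy
    · exact absurd hx0 (h x hx)
  have hk : ∀ x ∈ D, (nroots (spz P x)).card = (nroots (spz P x₀)).card :=
    fun x hx => le_antisymm (hcc x₀ hx₀ x hx) (hcc x hx x₀ hx₀)
  obtain ⟨l, ξ, hmono, hroot, hcont⟩ := hPG.rootFun hk hDp
  have hξ0 : ∀ i, ∀ x ∈ D, (spz P x).eval (ξ i x) = 0 := fun i x hx => (hroot x hx _).2 ⟨i, rfl⟩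
  have hgr : ∀ i, ∀ q ∈ T, (∀ x ∈ D, (spz q x).eval (ξ i x) = 0) ∨ (∀ x ∈ D, (spz q x).eval (ξ i x) ≠ 0) :=
    fun i q hq => hPG.graph_inv hk hDp (hTG q hq) (hdvd q hq) (hξ0 i) (hcont i)
  have hsm : ∀ i, SmD D (ξ i) := by
    intro i β hβ hβD
    have h0 := hξ0 i x₀ hx₀
    rw [hP, spz_prod, eval_prod, Finset.prod_eq_zero_iff] at h0
    obtain ⟨q, hq, hq0⟩ := h0
    rw [hT, Finset.mem_filter] at hq
    obtain ⟨g, hg, hgne, hg0, hg1⟩ := simple_factor _ q hq.1 le_rfl hq.2 hq0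
    have hgT : g ∈ T := Finset.mem_filter.2 ⟨hg, hgne⟩
    have hgT' : derivative g ∈ T := by
      refine Finset.mem_filter.2 ⟨dHull_der hg, fun h => ?_⟩
      rw [h] at hg1; simp at hg1
    have H0 : ∀ x ∈ D, (spz g x).eval (ξ i x) = 0 := (hgr i g hgT).resolve_right fun h => h x₀ hx₀ hg0
    have H1 : ∀ x ∈ D, (spz (derivative g) x).eval (ξ i x) ≠ 0 :=
      (hgr i _ hgT').resolve_left fun h => hg1 (h x₀ hx₀)
    refine implicit_smooth (G := fun w => (spz g (β w.1)).eval w.2) ?_ ?_ (fun s => H0 _ (hβD s))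
      (fun s => ⟨_, H1 _ (hβD s), ?_⟩)
    · have := (mvpoly_contDiff ((MvPolynomial.finSuccEquiv ℝ m).symm g)).comp
        (cons_contDiff (W := ℝ × ℝ) (t := fun w => w.2) (x := fun w => β w.1) contDiff_snd
          (hβ.comp contDiff_fst))
      convert this using 1
      ext w
      simp only [Function.comp]
      rw [spz_eval]; simp
    · exact (hcont i).comp_continuous hβ.continuous hβD
    · rw [spz_derivative]
      exact (spz g (β s)).hasDerivAt _
  set gr : Fin l → Set (Fin (m + 1) → ℝ) := fun i => {p | Fin.tail p ∈ D ∧ p 0 = ξ i (Fin.tail p)} with hgrd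
  set bd : Finset (Fin l) → Set (Fin (m + 1) → ℝ) := fun A => {p | Fin.tail p ∈ D ∧
    ∀ j, (j ∈ A → ξ j (Fin.tail p) < p 0) ∧ (j ∉ A → p 0 < ξ j (Fin.tail p))} with hbdd
  have heval : ∀ (φ : MvPolynomial (Fin (m + 1)) ℝ) (p : Fin (m + 1) → ℝ), MvPolynomial.eval p φ =
      (spz (MvPolynomial.finSuccEquiv ℝ m φ) (Fin.tail p)).eval (p 0) := by
    intro φ p
    rw [← spz_eval, Fin.cons_self_tail]
  refine ⟨Set.range gr ∪ {E | E ∈ Set.range bd ∧ E.Nonempty},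
    (Set.finite_range _).union ((Set.finite_range bd).subset fun E h => h.1), ?_, ?_⟩
  · rintro E (⟨i, rfl⟩ | ⟨⟨A, rfl⟩, ⟨p₁, hp₁, hp₁'⟩⟩)
    · have h1 := cell_SC hD (E := gr i) (ξ i) (fun x hx => by simp [hgrd, hx]) (fun p hp => hp.1)
        (by
          rintro x t t' ⟨hx, ht⟩ ⟨hx', ht'⟩ r hr
          simp only [Fin.tail_cons, Fin.cons_zero] at *
          rw [ht, ht', segment_same] at hr
          exact ⟨by simpa using hx, by simpa using hr⟩) (hsm i)
      refine ⟨h1.1, fun φ hφ => ?_, h1.2⟩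
      by_cases hφT : MvPolynomial.finSuccEquiv ℝ m φ ∈ T
      · rcases hgr i _ hφT with h | h
        · left
          rintro p ⟨hp, hp'⟩
          rw [heval, hp']; exact h _ hp
        · right
          rintro p ⟨hp, hp'⟩
          rw [heval, hp']; exact h _ hp
      · left
        rintro p ⟨hp, hp'⟩
        rw [heval, hTn _ (dHull_self hφ) hφT _ hp, eval_zero]
    · obtain ⟨s, hs1, hs2⟩ := section_exists hmono hsm A hp₁ hp₁'
      have h1 := cell_SC hD (E := bd A) s (fun x hx => by
          refine ⟨by simpa using hx, ?_⟩
          simpa using hs2 x hx) (fun p hp => hp.1)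
        (by
          rintro x t t' ⟨hx, ht⟩ ⟨hx', ht'⟩ r hr
          refine ⟨hx, fun j => ⟨fun hj => ?_, fun hj => ?_⟩⟩
          · have := (convex_Ioi (ξ j x)).segment_subset ((ht j).1 hj) ((ht' j).1 hj) hr
            simpa using this
          · have := (convex_Iio (ξ j x)).segment_subset ((ht j).2 hj) ((ht' j).2 hj) hr
            simpa using this) hs1
      refine ⟨h1.1, fun φ hφ => ?_, h1.2⟩
      by_cases hφT : MvPolynomial.finSuccEquiv ℝ m φ ∈ T
      · right
        rintro p ⟨hp, hp'⟩ h0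
        rw [heval] at h0
        have h0' := eval_eq_zero_of_dvd_of_eval_eq_zero (hdvd _ hφT _ hp) h0
        obtain ⟨j, hj⟩ := (hroot _ hp _).1 h0'
        by_cases hjA : j ∈ A
        · exact absurd hj ((hp' j).1 hjA).ne
        · exact absurd hj ((hp' j).2 hjA).ne'
      · left
        rintro p ⟨hp, hp'⟩
        rw [heval, hTn _ (dHull_self hφ) hφT _ hp, eval_zero]
  · intro p hp
    by_cases hroot : ∃ i, p 0 = ξ i (Fin.tail p)
    · obtain ⟨i, hi⟩ := hroot
      exact ⟨gr i, Or.inl ⟨i, rfl⟩, hp, hi⟩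
    · push Not at hroot
      have : p ∈ bd (Finset.univ.filter fun j => ξ j (Fin.tail p) < p 0) := by
        refine ⟨hp, fun j => ⟨fun hj => by simpa using hj, fun hj => ?_⟩⟩
        simp at hj
        exact lt_of_le_of_ne hj (hroot j)
      exact ⟨_, Or.inr ⟨⟨_, rfl⟩, ⟨p, this⟩⟩, this⟩

end elim

end

section
open Filter Topology
open scoped ContDiff

theorem cover_all : ∀ (n : ℕ) (Ψ : Finset (MvPolynomial (Fin n) ℝ)),
    ∃ 𝒞 : Set (Set (Fin n → ℝ)), 𝒞.Finite ∧ (∀ E ∈ 𝒞, SC E ∧ ZInv Ψ E) ∧ Set.univ ⊆ ⋃₀ 𝒞 := by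
  intro n
  induction n with
  | zero =>
    intro Ψ
    refine ⟨{Set.univ}, Set.finite_singleton _, ?_, by simp⟩
    rintro E rfl
    constructor
    · intro a _ b _
      rw [Subsingleton.elim b a]
      exact SJ.refl (Set.mem_univ _)
    · intro ψ _
      by_cases h : MvPolynomial.eval (0 : Fin 0 → ℝ) ψ = 0
      · left; intro x _; rwa [Subsingleton.elim x 0]
      · right; intro x _; rwa [Subsingleton.elim x 0]
  | succ n ih =>
    intro Φ
    obtain ⟨𝒟, hf, h1, h2⟩ := ih (projSet Φ)
    have := fun D (hD : D ∈ 𝒟) => elim_step Φ (h1 D hD).1 (h1 D hD).2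
    choose! c hc1 hc2 hc3 using this
    refine ⟨⋃ D ∈ 𝒟, c D, hf.biUnion hc1, ?_, ?_⟩
    · intro E hE
      simp only [Set.mem_iUnion] at hE
      obtain ⟨D, hD, hE⟩ := hE
      exact ⟨(hc2 D hD E hE).1, (hc2 D hD E hE).2.1⟩
    · intro p _
      obtain ⟨D, hD, hp⟩ := h2 (Set.mem_univ (Fin.tail p))
      obtain ⟨E, hE, hpE⟩ := hc3 D hD hp
      exact ⟨E, by simp only [Set.mem_iUnion]; exact ⟨D, hD, hE⟩, hpE⟩

theorem elim_many (N : ℕ) : ∀ (k : ℕ) (Φ : Finset (MvPolynomial (Fin (N + k)) ℝ)),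
    ∃ Ψ : Finset (MvPolynomial (Fin N) ℝ), ∀ D, SC D → ZInv Ψ D →
    ∃ 𝒞 : Set (Set (Fin (N + k) → ℝ)), 𝒞.Finite ∧
      (∀ E ∈ 𝒞, ZInv Φ E ∧ (fun (p : Fin (N + k) → ℝ) (i : Fin N) => p (i.addNat k)) '' E = D) ∧
      (fun (p : Fin (N + k) → ℝ) (i : Fin N) => p (i.addNat k)) ⁻¹' D ⊆ ⋃₀ 𝒞 ∧ ∀ E ∈ 𝒞, SC E := by
  intro k
  induction k with
  | zero =>
    intro Φ
    refine ⟨Φ, fun D hD hI => ⟨{D}, Set.finite_singleton _, ?_, ?_, ?_⟩⟩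
    · rintro E rfl
      exact ⟨hI, by simp⟩
    · simp
    · rintro E rfl; exact hD
  | succ k ih =>
    intro Φ
    obtain ⟨Ψ, hΨ⟩ := ih (projSet Φ)
    refine ⟨Ψ, fun D hD hI => ?_⟩
    obtain ⟨𝒟, hf, h1, h2, h3⟩ := hΨ D hD hI
    have := fun F (hF : F ∈ 𝒟) => elim_step Φ (h3 F hF) (h1 F hF).1
    choose! c hc1 hc2 hc3 using this
    refine ⟨⋃ F ∈ 𝒟, c F, hf.biUnion hc1, ?_, ?_, ?_⟩
    · intro E hE
      simp only [Set.mem_iUnion] at hE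
      obtain ⟨F, hF, hE⟩ := hE
      refine ⟨(hc2 F hF E hE).2.1, ?_⟩
      rw [← (h1 F hF).2, ← (hc2 F hF E hE).2.2, Set.image_image]
      rfl
    · intro p hp
      obtain ⟨F, hF, hpF⟩ := h2 (show Fin.tail p ∈ _ from hp)
      obtain ⟨E, hE, hpE⟩ := hc3 F hF hpF
      exact ⟨E, by simp only [Set.mem_iUnion]; exact ⟨F, hF, hE⟩, hpE⟩
    · intro E hE
      simp only [Set.mem_iUnion] at hE
      obtain ⟨F, hF, hE⟩ := hE
      exact (hc2 F hF E hE).1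

theorem re_im_poly {n M : ℕ} (α β : Fin n → MvPolynomial (Fin M) ℝ) (f : MvPolynomial (Fin n) ℂ) :
    ∃ u v : MvPolynomial (Fin M) ℝ, ∀ p : Fin M → ℝ,
      MvPolynomial.eval (fun j => (⟨MvPolynomial.eval p (α j), MvPolynomial.eval p (β j)⟩ : ℂ)) f
        = ⟨MvPolynomial.eval p u, MvPolynomial.eval p v⟩ := by
  induction f using MvPolynomial.induction_on with
  | C a => exact ⟨.C a.re, .C a.im, fun p => by simp⟩
  | add f g hf hg =>
    obtain ⟨u, v, h⟩ := hf
    obtain ⟨u', v', h'⟩ := hg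
    refine ⟨u + u', v + v', fun p => ?_⟩
    rw [map_add, h, h', map_add, map_add]; rfl
  | mul_X f i hf =>
    obtain ⟨u, v, h⟩ := hf
    refine ⟨u * α i - v * β i, u * β i + v * α i, fun p => ?_⟩
    rw [map_mul, h, MvPolynomial.eval_X]
    apply Complex.ext <;> simp

theorem cells {n : ℕ} (f : MvPolynomial (Fin n) ℂ) :
    ∃ 𝒞 : Set (Set (Fin n → ℝ)), 𝒞.Finite ∧
      (∀ E ∈ 𝒞, SC E ∧ (E ⊆ (imagProj f)ᶜ ∨ E ⊆ imagProj f)) ∧ Set.univ ⊆ ⋃₀ 𝒞 := by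
  obtain ⟨u, v, huv⟩ := re_im_poly (M := n + n) (fun j => .X (j.castAdd n)) (fun j => .X (j.addNat n)) f
  simp only [MvPolynomial.eval_X] at huv
  obtain ⟨Ψ, hΨ⟩ := elim_many n n {u * u + v * v}
  obtain ⟨𝒞, h0, h1, h2⟩ := cover_all n Ψ
  refine ⟨𝒞, h0, fun D hD => ⟨(h1 D hD).1, ?_⟩, h2⟩
  obtain ⟨𝓔, -, he1, he2, -⟩ := hΨ D (h1 D hD).1 (h1 D hD).2
  have hz : ∀ p : Fin (n + n) → ℝ, MvPolynomial.eval p (u * u + v * v) = 0 ↔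
      MvPolynomial.eval (fun j : Fin n => (⟨p (j.castAdd n), p (j.addNat n)⟩ : ℂ)) f = 0 := by
    intro p
    rw [huv p, Complex.ext_iff]
    simp only [map_add, map_mul, Complex.zero_re, Complex.zero_im]
    constructor
    · intro h; constructor <;> nlinarith [mul_self_nonneg (MvPolynomial.eval p u), mul_self_nonneg (MvPolynomial.eval p v)]
    · rintro ⟨h, h'⟩; simp [h, h']
  by_cases hE : ∃ E ∈ 𝓔, ∀ p ∈ E, MvPolynomial.eval p (u * u + v * v) = 0
  · right
    obtain ⟨E, hE, h⟩ := hE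
    intro y hy
    rw [← (he1 E hE).2] at hy
    obtain ⟨p, hp, rfl⟩ := hy
    exact ⟨_, (hz p).1 (h p hp), rfl⟩
  · left
    push Not at hE
    rintro y hy ⟨z, hz0, hzy⟩
    set p : Fin (n + n) → ℝ := Fin.append (fun j => (z j).re) (fun j => (z j).im) with hp
    have hpa : ∀ j : Fin n, p (j.addNat n) = (z j).im := by
      intro j
      have : j.addNat n = Fin.natAdd n j := by ext; simp [add_comm]
      rw [this, hp, Fin.append_right]
    have hpz : MvPolynomial.eval p (u * u + v * v) = 0 := by
      rw [hz]
      have hpe : (fun j : Fin n => (⟨p (j.castAdd n), p (j.addNat n)⟩ : ℂ)) = z := by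
        funext j
        rw [hpa, hp, Fin.append_left]
      rw [hpe]; exact hz0
    obtain ⟨E, hEm, hpE⟩ := he2 (show p ∈ _ by
      show (fun i : Fin n => p (i.addNat n)) ∈ D
      rw [← hzy] at hy
      convert hy using 1
      ext1 j; exact hpa j)
    obtain ⟨q, hq, hq0⟩ := hE E hEm
    rcases (he1 E hEm).1 _ (Finset.mem_singleton_self _) with h | h
    · exact hq0 (h q hq)
    · exact h p hpE hpz

end

section
open Filter Topology
open scoped ContDiff

/-- complex exponential kernel -/
noncomputable def ek (n : ℤ) (θ : ℝ) : ℂ := Complex.exp (2 * Real.pi * Complex.I * n * θ)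

theorem ek_norm (n : ℤ) (θ : ℝ) : ‖ek n θ‖ = 1 := by
  have : (2 * Real.pi * Complex.I * n * θ : ℂ) = ((2 * Real.pi * n * θ : ℝ) : ℂ) * Complex.I := by
    push_cast; ring
  rw [ek, this, Complex.norm_exp_ofReal_mul_I]

theorem ek_hasDeriv (n : ℤ) (θ : ℝ) : HasDerivAt (ek n) (2 * Real.pi * Complex.I * n * ek n θ) θ := by
  have h1 : HasDerivAt (fun t : ℝ => (2 * Real.pi * Complex.I * n * t : ℂ)) (2 * Real.pi * Complex.I * n) θ := by
    simpa using (Complex.ofRealCLM.hasDerivAt (x := θ)).const_mul (2 * Real.pi * Complex.I * n : ℂ)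
  have := h1.cexp
  unfold ek
  rw [mul_comm (2 * Real.pi * Complex.I * n : ℂ) (Complex.exp _)]
  exact this

theorem ek_cont (n : ℤ) : Continuous (ek n) := by
  unfold ek; fun_prop

theorem ek_conj (n : ℤ) (θ : ℝ) : (starRingEnd ℂ) (ek n θ) = ek (-n) θ := by
  unfold ek
  rw [← Complex.exp_conj]
  congr 1
  have h2 : (starRingEnd ℂ) 2 = 2 := Complex.conj_ofNat 2
  simp [h2]

/-- Fourier coefficients -/
noncomputable def fc (g : ℝ → ℝ) (n : ℤ) : ℂ := ∫ θ in (0:ℝ)..1, ek (-n) θ * (g θ : ℂ)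

theorem fc_norm {g : ℝ → ℝ} {M : ℝ} (h : ∀ θ ∈ Set.Icc (0:ℝ) 1, |g θ| ≤ M) (n : ℤ) : ‖fc g n‖ ≤ M := by
  have := intervalIntegral.norm_integral_le_of_norm_le_const (a := 0) (b := 1) (C := M)
    (f := fun θ => ek (-n) θ * (g θ : ℂ)) (by
      intro x hx
      rw [Set.uIoc_of_le zero_le_one] at hx
      rw [norm_mul, ek_norm, one_mul, Complex.norm_real]
      exact h x ⟨hx.1.le, hx.2⟩)
  simpa [fc] using this

theorem fc_deriv {g g' : ℝ → ℝ} (h : ∀ θ, HasDerivAt g (g' θ) θ) (hc : Continuous g')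
    (h0 : g 0 = 0) (h1 : g 1 = 0) (n : ℤ) : fc g' n = 2 * Real.pi * Complex.I * n * fc g n := by
  unfold fc
  rw [intervalIntegral.integral_mul_deriv_eq_deriv_mul (u := ek (-n)) (v := fun θ => (g θ : ℂ))
    (u' := fun θ => 2 * Real.pi * Complex.I * ((-n : ℤ) : ℂ) * ek (-n) θ)
    (v' := fun θ => (g' θ : ℂ)) (fun x _ => ek_hasDeriv _ _) (fun x _ => (h x).ofReal_comp)
    ((continuous_const.mul (ek_cont _)).intervalIntegrable _ _)
    ((Complex.continuous_ofReal.comp hc).intervalIntegrable _ _)]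
  simp only [h0, h1, Complex.ofReal_zero, mul_zero, sub_zero, zero_sub]
  rw [← intervalIntegral.integral_const_mul, ← intervalIntegral.integral_neg]
  congr 1
  ext θ
  push_cast; ring

theorem fc_conj (g : ℝ → ℝ) (n : ℤ) : (starRingEnd ℂ) (fc g n) = fc g (-n) := by
  unfold fc
  rw [← intervalIntegral.intervalIntegral_conj]
  congr 1
  ext θ
  rw [map_mul, ek_conj, Complex.conj_ofReal]

theorem fc_bound {g g' g'' : ℝ → ℝ} (h : ∀ θ, HasDerivAt g (g' θ) θ) (h' : ∀ θ, HasDerivAt g' (g'' θ) θ)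
    (hc : Continuous g'') (h0 : g 0 = 0) (h1 : g 1 = 0) (h0' : g' 0 = 0) (h1' : g' 1 = 0) {M : ℝ}
    (hM : ∀ θ ∈ Set.Icc (0:ℝ) 1, |g θ| ≤ M) (hM' : ∀ θ ∈ Set.Icc (0:ℝ) 1, |g'' θ| ≤ M) (n : ℤ) :
    ‖fc g n‖ ≤ 2 * M / (1 + (n : ℝ) ^ 2) := by
  have hgc : Continuous g' := continuous_iff_continuousAt.2 fun θ => (h' θ).continuousAt
  have e1 := fc_deriv h hgc h0 h1 n
  have e2 := fc_deriv h' hc h0' h1' n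
  have b0 := fc_norm hM n
  have b2 := fc_norm hM' n
  rw [e2, e1, norm_mul _ (_ * fc g n), norm_mul _ (fc g n)] at b2
  have hn : ‖(2 * Real.pi * Complex.I * n : ℂ)‖ = 2 * Real.pi * |(n:ℝ)| := by
    simp [abs_of_pos Real.pi_pos]
  rw [hn] at b2
  rw [le_div_iff₀ (by positivity)]
  have h3 : (n:ℝ)^2 * ‖fc g n‖ ≤ M := by
    refine le_trans ?_ b2
    have : 2 * Real.pi * |(n:ℝ)| * (2 * Real.pi * |(n:ℝ)| * ‖fc g n‖) = (2 * Real.pi)^2 * ((n:ℝ)^2 * ‖fc g n‖) := by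
      rw [← sq_abs (n:ℝ)]; ring
    rw [this]
    have hp : (1:ℝ) ≤ (2 * Real.pi)^2 := by nlinarith [Real.pi_gt_three]
    exact le_mul_of_one_le_left (by positivity) hp
  nlinarith

theorem bd_summable (M : ℝ) : Summable fun n : ℕ => 2 * M / (1 + (n : ℝ) ^ 2) := by
  have h1 : Summable fun n : ℕ => 1 / (1 + (n : ℝ) ^ 2) := by
    have h2 : Summable fun n : ℕ => 2 * (1 / ((n + 1 : ℕ) : ℝ) ^ 2) :=
      ((summable_nat_add_iff 1).2 (Real.summable_one_div_nat_pow.2 one_lt_two)).mul_left 2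
    refine Summable.of_nonneg_of_le (fun n => by positivity) (fun n => ?_) h2
    rw [mul_one_div, div_le_div_iff₀ (by positivity) (by positivity)]
    push_cast
    nlinarith [sq_nonneg ((n:ℝ) - 1)]
  simpa [div_eq_mul_inv] using h1.mul_left (2 * M)

theorem fc_series {g : ℝ → ℝ} (hg : Continuous g) (h01 : g 0 = g 1) {M : ℝ}
    (hb : ∀ n, ‖fc g n‖ ≤ 2 * M / (1 + (n : ℝ) ^ 2)) {θ : ℝ} (hθ : θ ∈ Set.Icc (0:ℝ) 1) :
    (Complex.I * (2 * (∑' n : ℕ, fc g n * ek n θ) - fc g 0)).im = g θ := by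
  have : Fact ((0:ℝ) < 1) := ⟨one_pos⟩
  have hcont : Continuous (AddCircle.liftIco (1:ℝ) 0 fun t => (g t : ℂ)) :=
    AddCircle.liftIco_continuous (by simp [h01]) (Complex.continuous_ofReal.comp hg).continuousOn
  set f : C(AddCircle (1:ℝ), ℂ) := ⟨_, hcont⟩ with hf
  have hfv : ∀ t ∈ Set.Icc (0:ℝ) 1, f (t : AddCircle (1:ℝ)) = g t := by
    intro t ht
    rcases eq_or_lt_of_le ht.2 with rfl | hlt
    · have : ((1:ℝ) : AddCircle (1:ℝ)) = ((0:ℝ) : AddCircle (1:ℝ)) := by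
        rw [AddCircle.coe_period]; simp
      rw [this]
      show AddCircle.liftIco (1:ℝ) 0 (fun t => (g t : ℂ)) ((0:ℝ) : AddCircle (1:ℝ)) = _
      rw [AddCircle.liftIco_coe_apply (by simp), h01]
    · exact AddCircle.liftIco_coe_apply (f := fun t => (g t : ℂ)) ⟨ht.1, by simpa using hlt⟩
  have hfo : ∀ (n : ℤ) (t : ℝ), fourier n (t : AddCircle (1:ℝ)) = ek n t := by
    intro n t; rw [fourier_coe_apply, ek]; simp
  have hco : ∀ n, fourierCoeff f n = fc g n := by
    intro n
    rw [fourierCoeff_eq_intervalIntegral f n 0, fc]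
    simp only [one_div, inv_one, one_smul, zero_add]
    refine intervalIntegral.integral_congr fun t ht => ?_
    rw [Set.uIcc_of_le zero_le_one] at ht
    simp only [hfo, hfv t ht, smul_eq_mul]
  have hnat : Summable fun n : ℕ => fc g n := by
    refine Summable.of_norm_bounded (bd_summable M) fun n => ?_
    simpa using hb n
  have hneg : Summable fun n : ℕ => fc g (-n) := by
    refine Summable.of_norm_bounded (bd_summable M) fun n => ?_
    simpa using hb (-n)
  have hsum : Summable (fourierCoeff f) := by
    rw [show fourierCoeff (f : AddCircle (1:ℝ) → ℂ) = fc g from funext hco]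
    exact Summable.of_nat_of_neg hnat hneg
  have h1 := (has_pointwise_sum_fourier_series_of_summable hsum (θ : AddCircle (1:ℝ))).nat_add_neg
  simp only [hco, hfo, hfv θ hθ, smul_eq_mul] at h1
  have h2 := Complex.hasSum_re h1
  have hs : Summable fun n : ℕ => fc g n * ek n θ := by
    refine Summable.of_norm_bounded (bd_summable M) fun n => ?_
    rw [norm_mul, ek_norm, mul_one]; simpa using hb n
  have h3 := (Complex.hasSum_re hs.hasSum).mul_left 2
  have h4 : (fun n : ℕ => (fc g (n:ℤ) * ek (n:ℤ) θ + fc g (-(n:ℤ)) * ek (-(n:ℤ)) θ).re)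
      = fun n : ℕ => 2 * (fc g (n:ℤ) * ek (n:ℤ) θ).re := by
    ext n
    rw [← fc_conj, ← ek_conj, ← map_mul, Complex.add_re, Complex.conj_re]; ring
  rw [h4] at h2
  have h5 := h3.unique h2
  have h6 : ek 0 θ = 1 := by simp [ek]
  rw [h6] at h5
  rw [Complex.I_mul_im, Complex.sub_re]
  simp at h5 ⊢
  linarith

end

section
open Filter Topology
open scoped ContDiff

theorem partial_smooth {W : ℝ × ℝ → ℝ} (hW : ContDiff ℝ ∞ W) :
    ∃ W' : ℝ × ℝ → ℝ, ContDiff ℝ ∞ W' ∧ ∀ s θ, HasDerivAt (fun t => W (s, t)) (W' (s, θ)) θ := by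
  refine ⟨fun p => fderiv ℝ W p (0, 1), ?_, fun s θ => ?_⟩
  · exact (hW.fderiv_right (m := ∞) (by simp)).clm_apply contDiff_const
  · have h3 : HasDerivAt (fun t : ℝ => ((s, t) : ℝ × ℝ)) ((0 : ℝ), (1 : ℝ)) θ :=
      (hasDerivAt_const _ _).prodMk (hasDerivAt_id _)
    exact HasFDerivAt.comp_hasDerivAt θ ((hW.differentiable (by simp) (s, θ)).hasFDerivAt) h3

theorem disc_exists {u : ℝ × ℝ → ℝ} (hu : ContDiff ℝ ∞ u) {c h : ℝ} (hh : 0 < h)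
    (hl : ∀ s θ, θ ≤ h → u (s, θ) = c) (hr : ∀ s θ, 1 - h ≤ θ → u (s, θ) = c)
    (h0 : ∀ θ, u (0, θ) = c) :
    ∃ Φ : ℝ → ℂ → ℂ, ContinuousOn (fun p : ℝ × ℂ => Φ p.1 p.2) (Set.Icc 0 1 ×ˢ Metric.closedBall 0 1) ∧
      (∀ s ∈ Set.Icc (0:ℝ) 1, DifferentiableOn ℂ (Φ s) (Metric.ball 0 1)) ∧
      (∀ s ∈ Set.Icc (0:ℝ) 1, ∀ θ ∈ Set.Icc (0:ℝ) 1, (Φ s (ek 1 θ)).im = u (s, θ)) ∧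
      (∀ s, (Φ s 0).im = ∫ θ in (0:ℝ)..1, u (s, θ)) ∧ ∀ ζ, (Φ 0 ζ).im = c := by
  set W : ℝ × ℝ → ℝ := fun p => u p - c with hWd
  have hW : ContDiff ℝ ∞ W := hu.sub contDiff_const
  obtain ⟨W', hW', hd⟩ := partial_smooth hW
  obtain ⟨W'', hW'', hd'⟩ := partial_smooth hW'
  have e0 : ∀ s, W (s, 0) = 0 := fun s => by simp [hWd, hl s 0 hh.le]
  have e1 : ∀ s, W (s, 1) = 0 := fun s => by simp [hWd, hr s 1 (by linarith)]
  have e0' : ∀ s, W' (s, 0) = 0 := fun s => by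
    refine (hd s 0).unique ?_
    refine (hasDerivAt_const (0:ℝ) (0:ℝ)).congr_of_eventuallyEq ?_
    filter_upwards [Iio_mem_nhds hh] with θ hθ
    simp [hWd, hl s θ (le_of_lt hθ)]
  have e1' : ∀ s, W' (s, 1) = 0 := fun s => by
    refine (hd s 1).unique ?_
    refine (hasDerivAt_const (1:ℝ) (0:ℝ)).congr_of_eventuallyEq ?_
    filter_upwards [Ioi_mem_nhds (show 1 - h < 1 by linarith)] with θ hθ
    simp [hWd, hr s θ (le_of_lt hθ)]
  have hK : IsCompact (Set.Icc (0:ℝ) 1 ×ˢ Set.Icc (0:ℝ) 1) := isCompact_Icc.prod isCompact_Icc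
  obtain ⟨M1, hM1⟩ := hK.exists_bound_of_continuousOn hW.continuous.continuousOn
  obtain ⟨M2, hM2⟩ := hK.exists_bound_of_continuousOn hW''.continuous.continuousOn
  set M := max M1 M2
  set g : ℝ → ℝ → ℝ := fun s θ => W (s, θ) with hg
  have hb : ∀ s ∈ Set.Icc (0:ℝ) 1, ∀ n, ‖fc (g s) n‖ ≤ 2 * M / (1 + (n:ℝ)^2) := by
    intro s hs n
    refine fc_bound (hd s) (hd' s) (hW''.continuous.comp (by fun_prop)) (e0 s) (e1 s) (e0' s) (e1' s) ?_ ?_ n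
    · intro θ hθ; exact (hM1 (s, θ) ⟨hs, hθ⟩).trans (le_max_left _ _)
    · intro θ hθ; exact (hM2 (s, θ) ⟨hs, hθ⟩).trans (le_max_right _ _)
  have hfcc : ∀ n, Continuous fun s => fc (g s) n := by
    intro n
    refine intervalIntegral.continuous_parametric_intervalIntegral_of_continuous' ?_ 0 1
    have h1 : Continuous fun p : ℝ × ℝ => ek (-n) p.2 := (ek_cont _).comp continuous_snd
    have h2 : Continuous fun p : ℝ × ℝ => ((W p : ℝ) : ℂ) := Complex.continuous_ofReal.comp hW.continuous
    exact h1.mul h2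
  have hterm : ∀ (n : ℕ), ∀ s ∈ Set.Icc (0:ℝ) 1, ∀ ζ : ℂ, ‖ζ‖ ≤ 1 →
      ‖fc (g s) n * ζ ^ n‖ ≤ 2 * M / (1 + (n:ℝ)^2) := by
    intro n s hs ζ hζ
    rw [norm_mul, norm_pow]
    have := hb s hs n
    simp only [Int.cast_natCast] at this
    refine le_trans (mul_le_of_le_one_right (norm_nonneg _) (pow_le_one₀ (norm_nonneg _) hζ)) this
  refine ⟨fun s ζ => Complex.I * (2 * (∑' n : ℕ, fc (g s) n * ζ ^ n) - fc (g s) 0) + Complex.I * c,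
    ?_, ?_, ?_, ?_, ?_⟩
  · have h1 : ContinuousOn (fun p : ℝ × ℂ => ∑' n : ℕ, fc (g p.1) n * p.2 ^ n)
        (Set.Icc 0 1 ×ˢ Metric.closedBall 0 1) := by
      refine continuousOn_tsum (fun n => Continuous.continuousOn ?_) (bd_summable M) ?_
      · exact ((hfcc n).comp continuous_fst).mul (continuous_snd.pow n)
      · rintro n ⟨s, ζ⟩ ⟨hs, hζ⟩
        exact hterm n s hs ζ (by simpa using hζ)
    have h2 : Continuous fun p : ℝ × ℂ => fc (g p.1) 0 := (hfcc 0).comp continuous_fst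
    exact (continuousOn_const.mul ((continuousOn_const.mul h1).sub h2.continuousOn)).add continuousOn_const
  · intro s hs
    have : DifferentiableOn ℂ (fun ζ : ℂ => ∑' n : ℕ, fc (g s) n * ζ ^ n) (Metric.ball 0 1) := by
      refine Complex.differentiableOn_tsum_of_summable_norm (bd_summable M) (fun n => ?_) Metric.isOpen_ball ?_
      · fun_prop
      · intro n ζ hζ
        exact hterm n s hs ζ (by simpa using (le_of_lt (by simpa using hζ : ‖ζ‖ < 1)))
    fun_prop
  · intro s hs θ hθ
    have := fc_series (g := g s) (hW.continuous.comp (by fun_prop)) (by simp [hg, e0, e1]) (hb s hs) hθ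
    have hpow : ∀ n : ℕ, (ek 1 θ) ^ n = ek n θ := by
      intro n
      unfold ek
      rw [← Complex.exp_nat_mul]
      congr 1; push_cast; ring
    simp only [hpow]
    rw [Complex.add_im, this]
    simp [hg, hWd]
  · intro s
    have h1 : ∑' n : ℕ, fc (g s) n * (0:ℂ) ^ n = fc (g s) 0 := by
      rw [tsum_eq_single 0]
      · simp
      · intro n hn; simp [hn]
    have h2 : fc (g s) 0 = ((∫ θ in (0:ℝ)..1, u (s, θ)) - c : ℝ) := by
      have h3 : ∫ θ in (0:ℝ)..1, g s θ = (∫ θ in (0:ℝ)..1, u (s, θ)) - c := by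
        simp only [hg, hWd]
        rw [intervalIntegral.integral_sub]
        · simp
        · exact (hu.continuous.comp (by fun_prop : Continuous fun θ : ℝ => (s, θ))).intervalIntegrable _ _
        · exact intervalIntegrable_const
      rw [← h3, ← intervalIntegral.integral_ofReal, fc]
      simp [ek]
    simp only [h1, h2]
    simp
    ring
  · intro ζ
    have hz : ∀ n, fc (g 0) n = 0 := by
      intro n
      simp [fc, hg, hWd, h0]
    simp [hz]

end

section
open Filter Topology
open scoped ContDiff

theorem mem_compl_imagProj {n : ℕ} {f : MvPolynomial (Fin n) ℂ} {y : Fin n → ℝ} :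
    y ∈ (imagProj f)ᶜ ↔ ∀ z : Fin n → ℂ, (∀ j, (z j).im = y j) → MvPolynomial.eval z f ≠ 0 := by
  simp only [imagProj, Set.mem_compl_iff, Set.mem_ofPred_eq, not_exists, not_and, funext_iff]
  exact ⟨fun h z h1 h2 => h z h2 h1, fun h z h1 h2 => h z h2 h1⟩

theorem eval_diff {n : ℕ} (f : MvPolynomial (Fin n) ℂ) {G : Fin n → ℂ → ℂ} {U : Set ℂ}
    (hG : ∀ j, DifferentiableOn ℂ (G j) U) :
    DifferentiableOn ℂ (fun w => MvPolynomial.eval (fun j => G j w) f) U := by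
  induction f using MvPolynomial.induction_on with
  | C a => simp
  | add p q hp hq => simp only [map_add]; exact hp.add hq
  | mul_X p i hp => simp only [map_mul, MvPolynomial.eval_X]; exact hp.mul (hG i)

theorem sphere_param {ζ : ℂ} (h : ‖ζ‖ = 1) : ∃ θ ∈ Set.Icc (0:ℝ) 1, ek 1 θ = ζ := by
  set t := Complex.arg ζ / (2 * Real.pi)
  refine ⟨Int.fract t, ⟨Int.fract_nonneg t, (Int.fract_lt_one t).le⟩, ?_⟩
  have h1 : ζ = Complex.exp (Complex.arg ζ * Complex.I) := by
    conv_lhs => rw [← Complex.norm_mul_exp_arg_mul_I ζ, h]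
    simp
  conv_rhs => rw [h1]
  rw [ek, Complex.exp_eq_exp_iff_exists_int]
  refine ⟨-⌊t⌋, ?_⟩
  have h2 : (Int.fract t : ℝ) = t - ⌊t⌋ := rfl
  have hp : (Real.pi : ℂ) ≠ 0 := by exact_mod_cast Real.pi_ne_zero
  have h3 : (t : ℂ) * (2 * Real.pi) = Complex.arg ζ := by
    simp only [t]; push_cast; field_simp
  rw [h2, ← h3]; push_cast; ring

/-- minimum modulus -/
theorem min_mod {F : ℂ → ℂ} {w : ℂ} {r δ : ℝ} (hr : 0 < r) (hd : DifferentiableOn ℂ F (Metric.ball w r))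
    (hc : ContinuousOn F (Metric.closedBall w r)) (hne : ∀ z ∈ Metric.closedBall w r, F z ≠ 0)
    (hδ : 0 < δ) (hs : ∀ z ∈ Metric.sphere w r, δ ≤ ‖F z‖) : ∀ z ∈ Metric.closedBall w r, δ ≤ ‖F z‖ := by
  intro z hz
  have hcl : closure (Metric.ball w r) = Metric.closedBall w r := closure_ball w hr.ne'
  have h1 : DiffContOnCl ℂ F (Metric.ball w r) := ⟨hd, by rwa [hcl]⟩
  have h2 := h1.inv (by rwa [hcl])
  have := Complex.norm_le_of_forall_mem_frontier_norm_le Metric.isBounded_ball h2 (C := δ⁻¹)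
    (by
      rw [frontier_ball w hr.ne']
      intro z hz
      rw [Pi.inv_apply, norm_inv]
      exact inv_anti₀ hδ (hs z hz)) (z := z) (by rwa [hcl])
  rw [Pi.inv_apply, norm_inv] at this
  exact (inv_le_inv₀ (norm_pos_iff.2 (hne z hz)) hδ).1 this

theorem homotopy_ne {F : ℝ → ℂ → ℂ}
    (hFc : ContinuousOn (fun p : ℝ × ℂ => F p.1 p.2) (Set.Icc 0 1 ×ˢ Metric.closedBall 0 1))
    (hFd : ∀ s ∈ Set.Icc (0:ℝ) 1, DifferentiableOn ℂ (F s) (Metric.ball 0 1))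
    (hFb : ∀ s ∈ Set.Icc (0:ℝ) 1, ∀ ζ ∈ Metric.sphere (0:ℂ) 1, F s ζ ≠ 0)
    (h0 : ∀ ζ ∈ Metric.closedBall (0:ℂ) 1, F 0 ζ ≠ 0) : F 1 0 ≠ 0 := by
  intro hF1
  have hKc : IsCompact (Set.Icc (0:ℝ) 1 ×ˢ Metric.closedBall (0:ℂ) 1) := isCompact_Icc.prod (isCompact_closedBall _ _)
  have hFcs : ∀ s ∈ Set.Icc (0:ℝ) 1, ContinuousOn (F s) (Metric.closedBall 0 1) := by
    intro s hs
    exact hFc.comp (f := fun ζ : ℂ => (s, ζ)) (by fun_prop) fun ζ hζ => ⟨hs, hζ⟩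
  obtain ⟨δ, hδ, hδb⟩ : ∃ δ, 0 < δ ∧ ∀ s ∈ Set.Icc (0:ℝ) 1, ∀ ζ ∈ Metric.sphere (0:ℂ) 1, δ ≤ ‖F s ζ‖ := by
    have hKs : IsCompact (Set.Icc (0:ℝ) 1 ×ˢ Metric.sphere (0:ℂ) 1) := isCompact_Icc.prod (isCompact_sphere _ _)
    have hcs : ContinuousOn (fun p : ℝ × ℂ => ‖F p.1 p.2‖) (Set.Icc (0:ℝ) 1 ×ˢ Metric.sphere (0:ℂ) 1) :=
      (hFc.mono (Set.prod_mono_right Metric.sphere_subset_closedBall)).norm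
    obtain ⟨p, hp, hmin⟩ := hKs.exists_isMinOn ⟨(0, 1), by simp⟩ hcs
    exact ⟨‖F p.1 p.2‖, norm_pos_iff.2 (hFb p.1 hp.1 p.2 hp.2), fun s hs ζ hζ => isMinOn_iff.1 hmin (s, ζ) ⟨hs, hζ⟩⟩
  have hMM : ∀ s ∈ Set.Icc (0:ℝ) 1, (∀ ζ ∈ Metric.closedBall (0:ℂ) 1, F s ζ ≠ 0) →
      ∀ ζ ∈ Metric.closedBall (0:ℂ) 1, δ ≤ ‖F s ζ‖ := fun s hs hne =>
    min_mod one_pos (hFd s hs) (hFcs s hs) hne hδ (hδb s hs)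
  set A : Set ℝ := {s | ∀ ζ ∈ Metric.closedBall (0:ℂ) 1, δ ≤ ‖F s ζ‖} with hA
  have hAc : IsClosed (A ∩ Set.Icc 0 1) := by
    have : A ∩ Set.Icc 0 1 = ⋂ ζ ∈ Metric.closedBall (0:ℂ) 1, (Set.Icc 0 1 ∩ (fun s => ‖F s ζ‖) ⁻¹' Set.Ici δ) := by
      ext s
      simp only [hA, Set.mem_inter_iff, Set.mem_ofPred_eq, Set.mem_iInter, Set.mem_preimage, Set.mem_Ici]
      exact ⟨fun h ζ hζ => ⟨h.2, h.1 ζ hζ⟩, fun h => ⟨fun ζ hζ => (h ζ hζ).2, (h 0 (by simp)).1⟩⟩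
    rw [this]
    refine isClosed_biInter fun ζ hζ => ?_
    refine ContinuousOn.preimage_isClosed_of_isClosed ?_ isClosed_Icc isClosed_Ici
    exact (hFc.comp (f := fun s : ℝ => (s, ζ)) (by fun_prop) fun s hs => ⟨hs, hζ⟩).norm
  have h0A : (0:ℝ) ∈ A := by
    exact hMM 0 (by simp) h0
  have hunif := Metric.uniformContinuousOn_iff.1 (hKc.uniformContinuousOn_of_continuous hFc) δ hδ
  obtain ⟨η, hη, hηu⟩ := hunif
  have h1A : (1:ℝ) ∈ A := by
    refine hAc.mem_of_ge_of_forall_exists_gt h0A zero_le_one ?_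
    rintro s ⟨hsA, hs0, hs1⟩
    have hlt : s < min 1 (s + η / 2) := lt_min hs1 (by linarith)
    have hle : min 1 (s + η / 2) ≤ s + η / 2 := min_le_right _ _
    have hle1 : min 1 (s + η / 2) ≤ 1 := min_le_left _ _
    refine ⟨min 1 (s + η / 2), ?_, hlt, hle1⟩
    refine hMM _ ⟨by linarith, hle1⟩ fun ζ hζ hzero => ?_
    have := hηu (s, ζ) ⟨⟨hs0, hs1.le⟩, hζ⟩ (min 1 (s + η / 2), ζ) ⟨⟨by linarith, hle1⟩, hζ⟩ (by
      rw [Prod.dist_eq, dist_self, max_eq_left dist_nonneg, Real.dist_eq, abs_lt]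
      constructor <;> linarith)
    simp only [hzero, dist_zero_right] at this
    exact absurd (hsA ζ hζ) (not_le.2 this)
  have := h1A 0 (by simp)
  rw [hF1, norm_zero] at this
  linarith

theorem disc_in {n : ℕ} {f : MvPolynomial (Fin n) ℂ} {γ : ℝ → Fin n → ℝ} (hγ : ContDiff ℝ ∞ γ)
    (hS : ∀ t, γ t ∈ (imagProj f)ᶜ) {τ : ℝ → ℝ} (hτ : ContDiff ℝ ∞ τ) {h : ℝ} (hh : 0 < h)
    (hl : ∀ θ, θ ≤ h → τ θ = 0) (hr : ∀ θ, 1 - h ≤ θ → τ θ = 0) :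
    (fun j => ∫ θ in (0:ℝ)..1, γ (τ θ) j) ∈ (imagProj f)ᶜ := by
  have hex := fun j => disc_exists (u := fun p : ℝ × ℝ => γ (p.1 * τ p.2) j) (c := γ 0 j) (h := h)
    (contDiff_pi.1 (hγ.comp (contDiff_fst.mul (hτ.comp contDiff_snd))) j) hh
    (fun s θ hθ => by simp [hl θ hθ]) (fun s θ hθ => by simp [hr θ hθ]) (fun θ => by simp)
  choose Φ hΦc hΦd hΦb hΦm hΦ0 using hex
  rw [mem_compl_imagProj]
  intro z hz hz0
  obtain ⟨x, hx⟩ : ∃ x : Fin n → ℝ, ∀ j, x j = (z j).re - (Φ j 1 0).re := ⟨_, fun j => rfl⟩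
  refine homotopy_ne (F := fun s ζ => MvPolynomial.eval (fun j => (x j : ℂ) + Φ j s ζ) f) ?_ ?_ ?_ ?_ ?_
  · have h1 : ContinuousOn (fun (p : ℝ × ℂ) j => (x j : ℂ) + Φ j p.1 p.2)
        (Set.Icc 0 1 ×ˢ Metric.closedBall 0 1) :=
      continuousOn_pi.2 fun j => continuousOn_const.add (hΦc j)
    exact (MvPolynomial.continuous_eval f).comp_continuousOn h1
  · intro s hs
    exact eval_diff f (G := fun j ζ => (x j : ℂ) + Φ j s ζ) fun j => (differentiableOn_const _).add (hΦd j s hs)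
  · intro s hs ζ hζ
    obtain ⟨θ, hθ, rfl⟩ := sphere_param (by simpa using hζ : ‖ζ‖ = 1)
    refine mem_compl_imagProj.1 (hS (s * τ θ)) _ fun j => ?_
    rw [Complex.add_im, hΦb j s hs θ hθ]; simp
  · intro ζ hζ
    refine mem_compl_imagProj.1 (hS 0) _ fun j => ?_
    rw [Complex.add_im, hΦ0 j ζ]; simp
  · have : (fun j => (x j : ℂ) + Φ j 1 0) = z := by
      funext j
      apply Complex.ext
      · simp [hx]
      · rw [Complex.add_im, hΦm j 1, hz j]; simp
    rw [this]; exact hz0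

theorem mean_calc {g : ℝ → ℝ} (hg : Continuous g) {h q : ℝ} (hh : 0 < h) (hq : 2 * h ≤ q) (hq1 : q + h ≤ 1) :
    ∫ θ in (0:ℝ)..1, g (Real.smoothTransition (θ / h - 1) + Real.smoothTransition ((1 + q / h) - θ / h) - 1)
      = g 0 + (q - 2 * h) * (g 1 - g 0) + 2 * h * ((∫ t in (0:ℝ)..1, g (Real.smoothTransition t)) - g 0) := by
  set ψ := Real.smoothTransition with hψ
  have hψc : Continuous ψ := Real.smoothTransition.continuous
  set G : ℝ → ℝ := fun θ => g (ψ (θ / h - 1) + ψ ((1 + q / h) - θ / h) - 1) with hG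
  have hGc : Continuous G := by fun_prop
  have hi : ∀ a b, IntervalIntegrable G MeasureTheory.volume a b := fun a b => hGc.intervalIntegrable a b
  have z1 : ∀ θ, θ ≤ h → ψ (θ / h - 1) = 0 := fun θ hθ => by
    refine Real.smoothTransition.zero_of_nonpos ?_
    have : θ / h ≤ 1 := (div_le_one hh).2 hθ
    linarith
  have o1 : ∀ θ, 2 * h ≤ θ → ψ (θ / h - 1) = 1 := fun θ hθ => by
    refine Real.smoothTransition.one_of_one_le ?_
    have : 2 ≤ θ / h := (le_div_iff₀ hh).2 hθ
    linarith
  have o2 : ∀ θ, θ ≤ q → ψ ((1 + q / h) - θ / h) = 1 := fun θ hθ => by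
    refine Real.smoothTransition.one_of_one_le ?_
    have : θ / h ≤ q / h := div_le_div_of_nonneg_right hθ hh.le
    linarith
  have z2 : ∀ θ, q + h ≤ θ → ψ ((1 + q / h) - θ / h) = 0 := fun θ hθ => by
    refine Real.smoothTransition.zero_of_nonpos ?_
    have : (q + h) / h ≤ θ / h := div_le_div_of_nonneg_right hθ hh.le
    rw [add_div, div_self hh.ne'] at this
    linarith
  have i1 : ∫ θ in (0:ℝ)..h, G θ = h * g 0 := by
    rw [intervalIntegral.integral_congr (g := fun _ => g 0)]
    · simp
    · intro θ hθ
      rw [Set.uIcc_of_le hh.le] at hθ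
      simp only [hG]
      rw [z1 θ hθ.2, o2 θ (by linarith [hθ.2])]; simp
  have i2 : ∫ θ in h..(2 * h), G θ = h * ∫ t in (0:ℝ)..1, g (ψ t) := by
    rw [intervalIntegral.integral_congr (g := fun θ => (fun t => g (ψ t)) (θ / h - 1))]
    · rw [intervalIntegral.integral_comp_div_sub (fun t => g (ψ t)) hh.ne']
      rw [div_self hh.ne', mul_div_assoc, div_self hh.ne', smul_eq_mul]
      norm_num
    · intro θ hθ
      rw [Set.uIcc_of_le (by linarith)] at hθ
      simp only [hG]
      rw [o2 θ (by linarith [hθ.2])]; simp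
  have i3 : ∫ θ in (2 * h)..q, G θ = (q - 2 * h) * g 1 := by
    rw [intervalIntegral.integral_congr (g := fun _ => g 1)]
    · simp
    · intro θ hθ
      rw [Set.uIcc_of_le hq] at hθ
      simp only [hG]
      rw [o1 θ hθ.1, o2 θ hθ.2]; simp
  have i4 : ∫ θ in q..(q + h), G θ = h * ∫ t in (0:ℝ)..1, g (ψ t) := by
    rw [intervalIntegral.integral_congr (g := fun θ => (fun t => g (ψ t)) ((1 + q / h) - θ / h))]
    · rw [intervalIntegral.integral_comp_sub_div (fun t => g (ψ t)) hh.ne']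
      rw [add_div, div_self hh.ne', smul_eq_mul]
      congr 2 <;> ring
    · intro θ hθ
      rw [Set.uIcc_of_le (by linarith)] at hθ
      simp only [hG]
      rw [o1 θ (by linarith [hθ.1])]; simp
  have i5 : ∫ θ in (q + h)..1, G θ = (1 - (q + h)) * g 0 := by
    rw [intervalIntegral.integral_congr (g := fun _ => g 0)]
    · simp
    · intro θ hθ
      rw [Set.uIcc_of_le hq1] at hθ
      simp only [hG]
      rw [o1 θ (by linarith [hθ.1]), z2 θ hθ.1]; simp
  rw [← intervalIntegral.integral_add_adjacent_intervals (hi 0 (q + h)) (hi (q + h) 1),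
    ← intervalIntegral.integral_add_adjacent_intervals (hi 0 q) (hi q (q + h)),
    ← intervalIntegral.integral_add_adjacent_intervals (hi 0 (2 * h)) (hi (2 * h) q),
    ← intervalIntegral.integral_add_adjacent_intervals (hi 0 h) (hi h (2 * h)), i1, i2, i3, i4, i5]
  ring

end

section
open Filter Topology
open scoped ContDiff

theorem hurwitz {n : ℕ} {f : MvPolynomial (Fin n) ℂ} {ι : Type*} {l : Filter ι} [l.NeBot]
    {a v : Fin n → ℝ} (ha : a ∈ (imagProj f)ᶜ) {q w : ι → Fin n → ℝ} (hq : Tendsto q l (𝓝 a))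
    (hw : Tendsto w l (𝓝 v)) {c δ : ℝ} (hδ : 0 < δ)
    (hS : ∀ᶠ k in l, ∀ t : ℝ, |t - c| < δ → q k + t • w k ∈ (imagProj f)ᶜ) :
    a + c • v ∈ (imagProj f)ᶜ := by
  rw [mem_compl_imagProj]
  intro z hz hz0
  obtain ⟨x, hx⟩ : ∃ x : Fin n → ℝ, ∀ j, x j = (z j).re := ⟨_, fun j => rfl⟩
  set pt : ((Fin n → ℝ) × (Fin n → ℝ)) → ℂ → Fin n → ℂ :=
    fun p ζ j => (x j : ℂ) + Complex.I * ((p.1 j : ℂ) + ζ * (p.2 j : ℂ)) with hpt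
  have hptim : ∀ p ζ j, (pt p ζ j).im = p.1 j + ζ.re * p.2 j := by
    intro p ζ j; simp [hpt]
  obtain ⟨G, hG⟩ : ∃ G : ((Fin n → ℝ) × (Fin n → ℝ)) → ℂ → ℂ, ∀ p ζ, G p ζ = MvPolynomial.eval (pt p ζ) f :=
    ⟨_, fun p ζ => rfl⟩
  have hGc : Continuous fun y : ((Fin n → ℝ) × (Fin n → ℝ)) × ℂ => G y.1 y.2 := by
    simp only [hG]
    refine (MvPolynomial.continuous_eval f).comp ?_
    refine continuous_pi fun j => ?_
    simp only [hpt]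
    fun_prop
  have hGd : ∀ p, Differentiable ℂ (G p) := by
    intro p
    rw [← differentiableOn_univ]
    have := eval_diff f (G := fun j ζ => pt p ζ j) (U := Set.univ) (fun j => by simp only [hpt]; fun_prop)
    rwa [show G p = fun ζ => MvPolynomial.eval (fun j => pt p ζ j) f from funext fun ζ => hG p ζ]
  have hGcc : G (a, v) c = 0 := by
    rw [hG, ← hz0]
    have : pt (a, v) c = z := by
      funext j
      apply Complex.ext
      · simp [hpt, hx]
      · rw [hptim, hz j]; simp
    rw [this]
  have hG0 : G (a, v) 0 ≠ 0 := by
    rw [hG]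
    refine mem_compl_imagProj.1 ha _ fun j => ?_
    rw [hptim]; simp
  have han : AnalyticOnNhd ℂ (G (a, v)) Set.univ :=
    (hGd (a, v)).differentiableOn.analyticOnNhd isOpen_univ
  have hiso : ∀ᶠ ζ in 𝓝[≠] (c : ℂ), G (a, v) ζ ≠ 0 := by
    rcases (han c (Set.mem_univ _)).eventually_eq_zero_or_eventually_ne_zero with h | h
    · exact absurd (han.eqOn_zero_of_preconnected_of_eventuallyEq_zero isPreconnected_univ
        (Set.mem_univ _) h (Set.mem_univ 0)) hG0
    · exact h
  rw [eventually_nhdsWithin_iff, Metric.eventually_nhds_iff] at hiso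
  obtain ⟨ε, hε, hiso⟩ := hiso
  set r := min ε δ / 2 with hr
  have hr0 : 0 < r := by have := lt_min hε hδ; positivity
  have hrε : r < ε := by have := lt_min hε hδ; have := min_le_left ε δ; linarith
  have hrδ : r < δ := by have := lt_min hε hδ; have := min_le_right ε δ; linarith
  have hsph : ∀ ζ ∈ Metric.sphere (c:ℂ) r, G (a, v) ζ ≠ 0 := by
    intro ζ hζ
    have hd : dist ζ c = r := hζ
    refine hiso (by rw [hd]; exact hrε) ?_
    intro h
    rw [Set.mem_singleton_iff] at h
    rw [h, dist_self] at hd; linarith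
  obtain ⟨p₀, hp₀, hmin⟩ := (isCompact_sphere (c:ℂ) r).exists_isMinOn
    (NormedSpace.sphere_nonempty.2 hr0.le) (hGd (a, v)).continuous.norm.continuousOn
  obtain ⟨η, hη⟩ : ∃ η, η = ‖G (a, v) p₀‖ / 2 := ⟨_, rfl⟩
  have hη0 : 0 < η := by
    have := norm_pos_iff.2 (hsph p₀ hp₀); rw [hη]; positivity
  have hev : ∀ᶠ p in 𝓝 (a, v), ∀ ζ ∈ Metric.sphere (c:ℂ) r, η < ‖G p ζ‖ := by
    refine (isCompact_sphere (c:ℂ) r).eventually_forall_of_forall_eventually fun ζ hζ => ?_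
    have h1 : η < ‖G (a, v) ζ‖ := by
      have := isMinOn_iff.1 hmin ζ hζ
      linarith
    exact (hGc.norm.tendsto ((a, v), ζ)).eventually_const_lt h1
  have htend : Tendsto (fun k => (q k, w k)) l (𝓝 (a, v)) := hq.prodMk_nhds hw
  have hfin : ∀ᶠ k in l, η ≤ ‖G (q k, w k) c‖ := by
    filter_upwards [htend.eventually hev, hS] with k hk hkS
    refine min_mod hr0 (hGd _).differentiableOn (hGd _).continuous.continuousOn (fun ζ hζ => ?_) hη0
      (fun ζ hζ => (hk ζ hζ).le) c (by simp [hr0.le])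
    rw [hG]
    refine mem_compl_imagProj.1 (hkS ζ.re ?_) _ fun j => ?_
    · have h1 : |(ζ - c).re| ≤ ‖ζ - c‖ := Complex.abs_re_le_norm _
      have h2 : ‖ζ - c‖ ≤ r := by simpa [dist_eq_norm] using hζ
      simp at h1
      linarith
    · rw [hptim]; simp
  have hlim : Tendsto (fun k => ‖G (q k, w k) c‖) l (𝓝 ‖G (a, v) c‖) := by
    have h1 : Continuous fun p => ‖G p c‖ := (hGc.comp (by fun_prop : Continuous fun p => (p, (c:ℂ)))).norm
    exact (h1.tendsto _).comp htend
  have := ge_of_tendsto hlim hfin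
  rw [hGcc, norm_zero] at this
  linarith

theorem thin {n : ℕ} {f : MvPolynomial (Fin n) ℂ} {a b : Fin n → ℝ} (h : SJ (imagProj f)ᶜ a b) :
    segment ℝ a b ⊆ (imagProj f)ᶜ := by
  obtain ⟨γ, hγ, hS, rfl, rfl⟩ := h
  rw [segment_eq_image']
  rintro _ ⟨μ, ⟨hμ0, hμ1⟩, rfl⟩
  rcases eq_or_lt_of_le hμ0 with rfl | hμ0
  · simpa using hS 0
  rcases eq_or_lt_of_le hμ1 with rfl | hμ1
  · simpa using hS 1
  set c : Fin n → ℝ := fun j => ∫ t in (0:ℝ)..1, γ (Real.smoothTransition t) j with hc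
  have key : ∀ h t : ℝ, 0 < h → 0 ≤ t → t ≤ 1 - 4 * h →
      (γ 0 + (2 * h) • (c - γ 0)) + t • (γ 1 - γ 0) ∈ (imagProj f)ᶜ := by
    intro h t hh ht0 ht1
    have hd := disc_in (f := f) hγ hS (h := h)
      (τ := fun θ => Real.smoothTransition (θ / h - 1) + Real.smoothTransition ((1 + (t + 2 * h) / h) - θ / h) - 1)
      ?_ hh ?_ ?_
    · convert hd using 1
      funext j
      rw [mean_calc (g := fun t => γ t j) ((continuous_apply j).comp hγ.continuous) hh (by linarith) (by linarith)]
      simp [hc]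
      ring
    · refine ((psi_contDiff.comp ?_).add (psi_contDiff.comp ?_)).sub contDiff_const
      · exact (contDiff_id.div_const h).sub contDiff_const
      · exact contDiff_const.sub (contDiff_id.div_const h)
    · intro θ hθ
      have h1 : θ / h ≤ 1 := (div_le_one hh).2 hθ
      have h2 : θ / h ≤ (t + 2 * h) / h := div_le_div_of_nonneg_right (by linarith) hh.le
      rw [Real.smoothTransition.zero_of_nonpos (by linarith), Real.smoothTransition.one_of_one_le (by linarith)]
      simp
    · intro θ hθ
      have h1 : 2 ≤ θ / h := (le_div_iff₀ hh).2 (by linarith)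
      have h2 : (t + 2 * h + h) / h ≤ θ / h := div_le_div_of_nonneg_right (by linarith) hh.le
      rw [add_div _ h, div_self hh.ne'] at h2
      rw [Real.smoothTransition.one_of_one_le (by linarith), Real.smoothTransition.zero_of_nonpos (by linarith)]
      simp
  refine hurwitz (l := 𝓝[>] (0:ℝ)) (q := fun h => γ 0 + (2 * h) • (c - γ 0)) (w := fun _ => γ 1 - γ 0)
    (hS 0) ?_ tendsto_const_nhds (c := μ) (δ := min μ (1 - μ) / 2) ?_ ?_
  · have h1 : Continuous fun h : ℝ => γ 0 + (2 * h) • (c - γ 0) := by fun_prop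
    have := h1.tendsto 0
    simp only [mul_zero, zero_smul, add_zero] at this
    exact this.mono_left nhdsWithin_le_nhds
  · have := lt_min hμ0 (sub_pos.2 hμ1); positivity
  · have hpos : 0 < (1 - μ) / 8 := by linarith
    have h2 : ∀ᶠ h in 𝓝[>] (0:ℝ), h < (1 - μ) / 8 := nhdsWithin_le_nhds (Iio_mem_nhds hpos)
    filter_upwards [h2, self_mem_nhdsWithin] with h hh hh0 t ht
    rw [abs_lt] at ht
    have h3 := min_le_left μ (1 - μ)
    have h4 := min_le_right μ (1 - μ)
    exact key h t hh0 (by linarith [ht.1]) (by linarith [ht.2])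

theorem main_result {n : ℕ} (f : MvPolynomial (Fin n) ℂ) :
    ∀ y ∈ (imagProj f)ᶜ, Convex ℝ (connectedComponentIn (imagProj f)ᶜ y) := by
  intro y hy
  set S := (imagProj f)ᶜ with hSd
  have hcl : ∀ a ∈ S, ∀ b ∈ S, b ∈ closure {b' | SJ S a b'} → SJ S a b := by
    intro a ha b hb hbc
    have : (𝓝[{b' | SJ S a b'}] b).NeBot := mem_closure_iff_nhdsWithin_neBot.1 hbc
    refine SJ.of_segment ?_
    rw [segment_eq_image']
    rintro _ ⟨μ, ⟨hμ0, hμ1⟩, rfl⟩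
    rcases eq_or_lt_of_le hμ0 with rfl | hμ0
    · simpa using ha
    rcases eq_or_lt_of_le hμ1 with rfl | hμ1
    · simpa using hb
    refine hurwitz (l := 𝓝[{b' | SJ S a b'}] b) (q := fun _ => a) (w := fun b' => b' - a) ha
      tendsto_const_nhds ?_ (δ := min μ (1 - μ)) (lt_min hμ0 (by linarith)) ?_
    · have h1 : Continuous fun b' : Fin n → ℝ => b' - a := by fun_prop
      exact (h1.tendsto b).mono_left nhdsWithin_le_nhds
    · filter_upwards [self_mem_nhdsWithin] with b' hb' t ht
      refine thin hb' ?_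
      rw [abs_lt] at ht
      have h3 := min_le_left μ (1 - μ)
      have h4 := min_le_right μ (1 - μ)
      rw [segment_eq_image']
      exact ⟨t, ⟨by linarith [ht.1], by linarith [ht.2]⟩, rfl⟩
  have hSJS : ∀ {a b}, SJ S a b → b ∈ S := by
    rintro a b ⟨γ, -, h, -, rfl⟩; exact h 1
  set C := connectedComponentIn S y with hC
  have hCS : C ⊆ S := connectedComponentIn_subset S y
  have hyC : y ∈ C := mem_connectedComponentIn hy
  have hCp : IsPreconnected C := isPreconnected_connectedComponentIn
  have hall : ∀ b ∈ C, SJ S y b := by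
    obtain ⟨𝒞, hfin, hcell, hcov⟩ := cells f
    set 𝒟 := {E ∈ 𝒞 | E ⊆ S ∧ ∀ e ∈ E, ¬ SJ S y e} with h𝒟
    have hDf : 𝒟.Finite := hfin.subset fun E h => h.1
    by_contra hcon
    push Not at hcon
    obtain ⟨b, hb, hbn⟩ := hcon
    have hcov2 : ∀ e ∈ S, ¬ SJ S y e → ∃ E ∈ 𝒟, e ∈ E := by
      intro e he hne
      obtain ⟨E, hE, heE⟩ := hcov (Set.mem_univ e)
      have hES : E ⊆ S := (hcell E hE).2.resolve_right fun h => he (h heE)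
      exact ⟨E, ⟨hE, hES, fun e' he' h => hne (h.trans (((hcell E hE).1 e' he' e heE).mono hES))⟩, heE⟩
    have hsep := isPreconnected_closed_iff.1 hCp (closure {e | SJ S y e}) (⋃ E ∈ 𝒟, closure E)
      isClosed_closure (hDf.isClosed_biUnion fun E _ => isClosed_closure) ?_
      ⟨y, hyC, subset_closure (SJ.refl hy)⟩ ?_
    · obtain ⟨e, heC, he1, he2⟩ := hsep
      have h1 := hcl y hy e (hCS heC) he1
      simp only [Set.mem_iUnion] at he2
      obtain ⟨E, hE, heE⟩ := he2
      have hne : E.Nonempty := closure_nonempty_iff.1 ⟨e, heE⟩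
      obtain ⟨e', he'⟩ := hne
      have h2 : SJ S e' e := hcl e' (hE.2.1 he') e (hCS heC)
        (closure_mono (fun e'' he'' => ((hcell E hE.1).1 e' he' e'' he'').mono hE.2.1) heE)
      exact hE.2.2 e' he' (h1.trans h2.symm)
    · intro e he
      by_cases hje : SJ S y e
      · exact Or.inl (subset_closure hje)
      · obtain ⟨E, hE, heE⟩ := hcov2 e (hCS he) hje
        right
        simp only [Set.mem_iUnion]
        exact ⟨E, hE, subset_closure heE⟩
    · obtain ⟨E, hE, hbE⟩ := hcov2 b (hCS hb) hbn
      refine ⟨b, hb, ?_⟩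
      simp only [Set.mem_iUnion]
      exact ⟨E, hE, subset_closure hbE⟩
  rw [convex_iff_segment_subset]
  intro a ha b hb
  have hseg := thin ((hall a ha).symm.trans (hall b hb))
  have h1 : segment ℝ a b ⊆ connectedComponentIn S a :=
    (convex_segment a b).isPreconnected.subset_connectedComponentIn (left_mem_segment ℝ a b) hseg
  rwa [← connectedComponentIn_eq ha] at h1

end

open MvPolynomial

theorem convex_components_of_complement {n : ℕ} (f : MvPolynomial (Fin n) ℂ)
    (hf : f ≠ 0) :
    ∀ y ∈ (imagProj f)ᶜ, Convex ℝ (connectedComponentIn (imagProj f)ᶜ y) := by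
  exact main_result f
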